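/- arXiv:1701.02345 — 2 statements merged into one kernel-verified Lean document; each statement's English description precedes it below -/
import Mathlib

section
/- Lemma (HK split): Let p denote the pmf p(s)p(t)p(u)p(v) with functions x(s,t) and w(u,v). Then 𝓡₁,MAC(p) ∩ 𝓡₂,MAC(p) = ⋃_{p' ≃ p} [ (⋃_{λ₁=1}^{3} ⋃_{λ₂=10}^{12} 𝓡₁(p',λ₁) ∩ 𝓡₂(p',λ₂)) ∪ (⋃_{λ₁=4}^{6} ⋃_{λ₂=7}^{9} 𝓡₁(p',λ₁) ∩ 𝓡₂(p',λ₂)) ]. -/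
open scoped BigOperators Classical

noncomputable section

/-- Pushforward of a finitely supported weight function along a map. -/
def pushf {Ω β : Type*} [Fintype Ω] (q : Ω → ℝ) (f : Ω → β) : β → ℝ :=
  fun b => ∑ ω, if f ω = b then q ω else 0

/-- Shannon entropy (in nats). -/
def ent {β : Type*} [Fintype β] (p : β → ℝ) : ℝ :=
  -∑ b, p b * Real.log (p b)

/-- Entropy of the random variable `A` under the joint pmf `q`. -/
def Hof {Ω β : Type*} [Fintype Ω] [Fintype β] (q : Ω → ℝ) (A : Ω → β) : ℝ :=
  ent (pushf q A)

/-- Mutual information `I(A;B)` under the joint pmf `q`. -/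
def miOf {Ω α β : Type*} [Fintype Ω] [Fintype α] [Fintype β]
    (q : Ω → ℝ) (A : Ω → α) (B : Ω → β) : ℝ :=
  Hof q A + Hof q B - Hof q (fun ω => (A ω, B ω))

/-- Conditional mutual information `I(A;B|C)` under the joint pmf `q`. -/
def cmiOf {Ω α β γ : Type*} [Fintype Ω] [Fintype α] [Fintype β] [Fintype γ]
    (q : Ω → ℝ) (A : Ω → α) (B : Ω → β) (C : Ω → γ) : ℝ :=
  Hof q (fun ω => (A ω, C ω)) + Hof q (fun ω => (B ω, C ω))
    - Hof q (fun ω => (A ω, B ω, C ω)) - Hof q C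

/-- `p` is a probability mass function. -/
def IsPMF {α : Type*} [Fintype α] (p : α → ℝ) : Prop :=
  (∀ a, 0 ≤ p a) ∧ ∑ a, p a = 1

/-- A refined split distribution for the Han–Kobayashi scheme: independent layers
`S₁,S₂,S₃,T₁,T₂,V₁,V₂` with recombination maps `fs, ft, fv`. -/
structure HKSplit (𝒮 𝒯 𝒰 𝒱 : Type) [Fintype 𝒮] [Fintype 𝒯] [Fintype 𝒰] [Fintype 𝒱] where
  S1 : Type
  S2 : Type
  S3 : Type
  T1 : Type
  T2 : Type
  V1 : Type
  V2 : Type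
  [finS1 : Fintype S1]
  [finS2 : Fintype S2]
  [finS3 : Fintype S3]
  [finT1 : Fintype T1]
  [finT2 : Fintype T2]
  [finV1 : Fintype V1]
  [finV2 : Fintype V2]
  pS1 : S1 → ℝ
  pS2 : S2 → ℝ
  pS3 : S3 → ℝ
  pT1 : T1 → ℝ
  pT2 : T2 → ℝ
  pV1 : V1 → ℝ
  pV2 : V2 → ℝ
  fs : S1 → S2 → S3 → 𝒮
  ft : T1 → T2 → 𝒯
  fv : V1 → V2 → 𝒱
  pS1_pmf : IsPMF pS1
  pS2_pmf : IsPMF pS2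
  pS3_pmf : IsPMF pS3
  pT1_pmf : IsPMF pT1
  pT2_pmf : IsPMF pT2
  pV1_pmf : IsPMF pV1
  pV2_pmf : IsPMF pV2

attribute [instance] HKSplit.finS1 HKSplit.finS2 HKSplit.finS3 HKSplit.finT1
  HKSplit.finT2 HKSplit.finV1 HKSplit.finV2

/-- `p' ≃ p`: the induced laws of `S = fs(S₁,S₂,S₃)`, `T = ft(T₁,T₂)`, `V = fv(V₁,V₂)`
match `pS`, `pT`, `pV`. -/
def HKSplit.Matches {𝒮 𝒯 𝒰 𝒱 : Type} [Fintype 𝒮] [Fintype 𝒯] [Fintype 𝒰] [Fintype 𝒱]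
    (s : HKSplit 𝒮 𝒯 𝒰 𝒱) (pS : 𝒮 → ℝ) (pT : 𝒯 → ℝ) (pV : 𝒱 → ℝ) : Prop :=
  (∀ a, pushf (fun x : s.S1 × s.S2 × s.S3 => s.pS1 x.1 * s.pS2 x.2.1 * s.pS3 x.2.2)
      (fun x => s.fs x.1 x.2.1 x.2.2) a = pS a) ∧
  (∀ a, pushf (fun x : s.T1 × s.T2 => s.pT1 x.1 * s.pT2 x.2)
      (fun x => s.ft x.1 x.2) a = pT a) ∧
  (∀ a, pushf (fun x : s.V1 × s.V2 => s.pV1 x.1 * s.pV2 x.2)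
      (fun x => s.fv x.1 x.2) a = pV a)

variable {𝒮 𝒯 𝒰 𝒱 𝒳 𝒲 𝒴₁ 𝒴₂ : Type}
  [Fintype 𝒮] [Fintype 𝒯] [Fintype 𝒰] [Fintype 𝒱]
  [Fintype 𝒳] [Fintype 𝒲] [Fintype 𝒴₁] [Fintype 𝒴₂]

/-- Joint pmf on `(S, T, U, V, Y₁, Y₂)` for the Han–Kobayashi scheme. -/
def hkBaseJoint (pS : 𝒮 → ℝ) (pT : 𝒯 → ℝ) (pU : 𝒰 → ℝ) (pV : 𝒱 → ℝ)
    (fx : 𝒮 → 𝒯 → 𝒳) (fw : 𝒰 → 𝒱 → 𝒲)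
    (ch : 𝒳 → 𝒲 → 𝒴₁ → 𝒴₂ → ℝ) : 𝒮 × 𝒯 × 𝒰 × 𝒱 × 𝒴₁ × 𝒴₂ → ℝ :=
  fun ω => pS ω.1 * pT ω.2.1 * pU ω.2.2.1 * pV ω.2.2.2.1 *
    ch (fx ω.1 ω.2.1) (fw ω.2.2.1 ω.2.2.2.1) ω.2.2.2.2.1 ω.2.2.2.2.2

/-- `𝓡₁,MAC`: quadruples `(R₁₀,R₁₁,R₂₀,R₂₂)` with `(R₁₀,R₁₁,R₂₀) ∈ 𝓡_MAC(S,T,U;Y₁)`. -/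
def R1MACHK (pS : 𝒮 → ℝ) (pT : 𝒯 → ℝ) (pU : 𝒰 → ℝ) (pV : 𝒱 → ℝ)
    (fx : 𝒮 → 𝒯 → 𝒳) (fw : 𝒰 → 𝒱 → 𝒲)
    (ch : 𝒳 → 𝒲 → 𝒴₁ → 𝒴₂ → ℝ) : Set (ℝ × ℝ × ℝ × ℝ) :=
  {r | 0 ≤ r.1 ∧ 0 ≤ r.2.1 ∧ 0 ≤ r.2.2.1 ∧ 0 ≤ r.2.2.2 ∧
    r.1 ≤ cmiOf (hkBaseJoint pS pT pU pV fx fw ch) (fun ω => ω.1)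
      (fun ω => ω.2.2.2.2.1) (fun ω => (ω.2.1, ω.2.2.1)) ∧
    r.2.1 ≤ cmiOf (hkBaseJoint pS pT pU pV fx fw ch) (fun ω => ω.2.1)
      (fun ω => ω.2.2.2.2.1) (fun ω => (ω.1, ω.2.2.1)) ∧
    r.2.2.1 ≤ cmiOf (hkBaseJoint pS pT pU pV fx fw ch) (fun ω => ω.2.2.1)
      (fun ω => ω.2.2.2.2.1) (fun ω => (ω.1, ω.2.1)) ∧
    r.1 + r.2.1 ≤ cmiOf (hkBaseJoint pS pT pU pV fx fw ch) (fun ω => (ω.1, ω.2.1))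
      (fun ω => ω.2.2.2.2.1) (fun ω => ω.2.2.1) ∧
    r.1 + r.2.2.1 ≤ cmiOf (hkBaseJoint pS pT pU pV fx fw ch) (fun ω => (ω.1, ω.2.2.1))
      (fun ω => ω.2.2.2.2.1) (fun ω => ω.2.1) ∧
    r.2.1 + r.2.2.1 ≤ cmiOf (hkBaseJoint pS pT pU pV fx fw ch) (fun ω => (ω.2.1, ω.2.2.1))
      (fun ω => ω.2.2.2.2.1) (fun ω => ω.1) ∧
    r.1 + r.2.1 + r.2.2.1 ≤ miOf (hkBaseJoint pS pT pU pV fx fw ch)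
      (fun ω => (ω.1, ω.2.1, ω.2.2.1)) (fun ω => ω.2.2.2.2.1)}

/-- `𝓡₂,MAC`: quadruples `(R₁₀,R₁₁,R₂₀,R₂₂)` with `(R₁₀,R₂₀,R₂₂) ∈ 𝓡_MAC(S,U,V;Y₂)`. -/
def R2MACHK (pS : 𝒮 → ℝ) (pT : 𝒯 → ℝ) (pU : 𝒰 → ℝ) (pV : 𝒱 → ℝ)
    (fx : 𝒮 → 𝒯 → 𝒳) (fw : 𝒰 → 𝒱 → 𝒲)
    (ch : 𝒳 → 𝒲 → 𝒴₁ → 𝒴₂ → ℝ) : Set (ℝ × ℝ × ℝ × ℝ) :=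
  {r | 0 ≤ r.1 ∧ 0 ≤ r.2.1 ∧ 0 ≤ r.2.2.1 ∧ 0 ≤ r.2.2.2 ∧
    r.1 ≤ cmiOf (hkBaseJoint pS pT pU pV fx fw ch) (fun ω => ω.1)
      (fun ω => ω.2.2.2.2.2) (fun ω => (ω.2.2.1, ω.2.2.2.1)) ∧
    r.2.2.1 ≤ cmiOf (hkBaseJoint pS pT pU pV fx fw ch) (fun ω => ω.2.2.1)
      (fun ω => ω.2.2.2.2.2) (fun ω => (ω.1, ω.2.2.2.1)) ∧
    r.2.2.2 ≤ cmiOf (hkBaseJoint pS pT pU pV fx fw ch) (fun ω => ω.2.2.2.1)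
      (fun ω => ω.2.2.2.2.2) (fun ω => (ω.1, ω.2.2.1)) ∧
    r.1 + r.2.2.1 ≤ cmiOf (hkBaseJoint pS pT pU pV fx fw ch) (fun ω => (ω.1, ω.2.2.1))
      (fun ω => ω.2.2.2.2.2) (fun ω => ω.2.2.2.1) ∧
    r.1 + r.2.2.2 ≤ cmiOf (hkBaseJoint pS pT pU pV fx fw ch) (fun ω => (ω.1, ω.2.2.2.1))
      (fun ω => ω.2.2.2.2.2) (fun ω => ω.2.2.1) ∧
    r.2.2.1 + r.2.2.2 ≤ cmiOf (hkBaseJoint pS pT pU pV fx fw ch)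
      (fun ω => (ω.2.2.1, ω.2.2.2.1)) (fun ω => ω.2.2.2.2.2) (fun ω => ω.1) ∧
    r.1 + r.2.2.1 + r.2.2.2 ≤ miOf (hkBaseJoint pS pT pU pV fx fw ch)
      (fun ω => (ω.1, ω.2.2.1, ω.2.2.2.1)) (fun ω => ω.2.2.2.2.2)}

/-- Joint pmf on `(S₁,S₂,S₃,T₁,T₂,U,V₁,V₂,Y₁,Y₂)` induced by a refined split `s`,
the pmf `pU` of the unsplit layer `U`, and the channel. -/
def hkJoint (fx : 𝒮 → 𝒯 → 𝒳) (fw : 𝒰 → 𝒱 → 𝒲)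
    (s : HKSplit 𝒮 𝒯 𝒰 𝒱) (pU : 𝒰 → ℝ) (ch : 𝒳 → 𝒲 → 𝒴₁ → 𝒴₂ → ℝ) :
    s.S1 × s.S2 × s.S3 × s.T1 × s.T2 × 𝒰 × s.V1 × s.V2 × 𝒴₁ × 𝒴₂ → ℝ :=
  fun ω => s.pS1 ω.1 * s.pS2 ω.2.1 * s.pS3 ω.2.2.1 * s.pT1 ω.2.2.2.1 *
    s.pT2 ω.2.2.2.2.1 * pU ω.2.2.2.2.2.1 * s.pV1 ω.2.2.2.2.2.2.1 * s.pV2 ω.2.2.2.2.2.2.2.1 *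
    ch (fx (s.fs ω.1 ω.2.1 ω.2.2.1) (s.ft ω.2.2.2.1 ω.2.2.2.2.1))
      (fw ω.2.2.2.2.2.1 (s.fv ω.2.2.2.2.2.2.1 ω.2.2.2.2.2.2.2.1))
      ω.2.2.2.2.2.2.2.2.1 ω.2.2.2.2.2.2.2.2.2
/-- Receiver-1 successive-cancellation region for layer order λ = 1:
`S1 → T1 → S2 → S3 → U → T2`. -/
def R1L1 (fx : 𝒮 → 𝒯 → 𝒳) (fw : 𝒰 → 𝒱 → 𝒲) (s : HKSplit 𝒮 𝒯 𝒰 𝒱) (pU : 𝒰 → ℝ)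
    (ch : 𝒳 → 𝒲 → 𝒴₁ → 𝒴₂ → ℝ) : Set (ℝ × ℝ × ℝ × ℝ) :=
  {r | 0 ≤ r.1 ∧ 0 ≤ r.2.1 ∧ 0 ≤ r.2.2.1 ∧ 0 ≤ r.2.2.2 ∧
    r.1 ≤ miOf (hkJoint fx fw s pU ch) (fun ω => ω.1) (fun ω => ω.2.2.2.2.2.2.2.2.1)
        + cmiOf (hkJoint fx fw s pU ch) (fun ω => ω.2.1) (fun ω => ω.2.2.2.2.2.2.2.2.1) (fun ω => (ω.1, ω.2.2.2.1))
        + cmiOf (hkJoint fx fw s pU ch) (fun ω => ω.2.2.1) (fun ω => ω.2.2.2.2.2.2.2.2.1) (fun ω => (ω.1, ω.2.2.2.1, ω.2.1)) ∧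
    r.2.1 ≤ cmiOf (hkJoint fx fw s pU ch) (fun ω => ω.2.2.2.1) (fun ω => ω.2.2.2.2.2.2.2.2.1) (fun ω => (ω.1))
        + cmiOf (hkJoint fx fw s pU ch) (fun ω => ω.2.2.2.2.1) (fun ω => ω.2.2.2.2.2.2.2.2.1) (fun ω => (ω.1, ω.2.2.2.1, ω.2.1, ω.2.2.1, ω.2.2.2.2.2.1)) ∧
    r.2.2.1 ≤ cmiOf (hkJoint fx fw s pU ch) (fun ω => ω.2.2.2.2.2.1) (fun ω => ω.2.2.2.2.2.2.2.2.1) (fun ω => (ω.1, ω.2.2.2.1, ω.2.1, ω.2.2.1))}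

/-- Receiver-1 successive-cancellation region for layer order λ = 2:
`T1 → U → S1 → T2 → S2 → S3`. -/
def R1L2 (fx : 𝒮 → 𝒯 → 𝒳) (fw : 𝒰 → 𝒱 → 𝒲) (s : HKSplit 𝒮 𝒯 𝒰 𝒱) (pU : 𝒰 → ℝ)
    (ch : 𝒳 → 𝒲 → 𝒴₁ → 𝒴₂ → ℝ) : Set (ℝ × ℝ × ℝ × ℝ) :=
  {r | 0 ≤ r.1 ∧ 0 ≤ r.2.1 ∧ 0 ≤ r.2.2.1 ∧ 0 ≤ r.2.2.2 ∧
    r.1 ≤ cmiOf (hkJoint fx fw s pU ch) (fun ω => ω.1) (fun ω => ω.2.2.2.2.2.2.2.2.1) (fun ω => (ω.2.2.2.1, ω.2.2.2.2.2.1))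
        + cmiOf (hkJoint fx fw s pU ch) (fun ω => ω.2.1) (fun ω => ω.2.2.2.2.2.2.2.2.1) (fun ω => (ω.2.2.2.1, ω.2.2.2.2.2.1, ω.1, ω.2.2.2.2.1))
        + cmiOf (hkJoint fx fw s pU ch) (fun ω => ω.2.2.1) (fun ω => ω.2.2.2.2.2.2.2.2.1) (fun ω => (ω.2.2.2.1, ω.2.2.2.2.2.1, ω.1, ω.2.2.2.2.1, ω.2.1)) ∧
    r.2.1 ≤ miOf (hkJoint fx fw s pU ch) (fun ω => ω.2.2.2.1) (fun ω => ω.2.2.2.2.2.2.2.2.1)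
        + cmiOf (hkJoint fx fw s pU ch) (fun ω => ω.2.2.2.2.1) (fun ω => ω.2.2.2.2.2.2.2.2.1) (fun ω => (ω.2.2.2.1, ω.2.2.2.2.2.1, ω.1)) ∧
    r.2.2.1 ≤ cmiOf (hkJoint fx fw s pU ch) (fun ω => ω.2.2.2.2.2.1) (fun ω => ω.2.2.2.2.2.2.2.2.1) (fun ω => (ω.2.2.2.1))}

/-- Receiver-1 successive-cancellation region for layer order λ = 3:
`T1 → S1 → U → S2 → S3 → T2`. -/
def R1L3 (fx : 𝒮 → 𝒯 → 𝒳) (fw : 𝒰 → 𝒱 → 𝒲) (s : HKSplit 𝒮 𝒯 𝒰 𝒱) (pU : 𝒰 → ℝ)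
    (ch : 𝒳 → 𝒲 → 𝒴₁ → 𝒴₂ → ℝ) : Set (ℝ × ℝ × ℝ × ℝ) :=
  {r | 0 ≤ r.1 ∧ 0 ≤ r.2.1 ∧ 0 ≤ r.2.2.1 ∧ 0 ≤ r.2.2.2 ∧
    r.1 ≤ cmiOf (hkJoint fx fw s pU ch) (fun ω => ω.1) (fun ω => ω.2.2.2.2.2.2.2.2.1) (fun ω => (ω.2.2.2.1))
        + cmiOf (hkJoint fx fw s pU ch) (fun ω => ω.2.1) (fun ω => ω.2.2.2.2.2.2.2.2.1) (fun ω => (ω.2.2.2.1, ω.1, ω.2.2.2.2.2.1))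
        + cmiOf (hkJoint fx fw s pU ch) (fun ω => ω.2.2.1) (fun ω => ω.2.2.2.2.2.2.2.2.1) (fun ω => (ω.2.2.2.1, ω.1, ω.2.2.2.2.2.1, ω.2.1)) ∧
    r.2.1 ≤ miOf (hkJoint fx fw s pU ch) (fun ω => ω.2.2.2.1) (fun ω => ω.2.2.2.2.2.2.2.2.1)
        + cmiOf (hkJoint fx fw s pU ch) (fun ω => ω.2.2.2.2.1) (fun ω => ω.2.2.2.2.2.2.2.2.1) (fun ω => (ω.2.2.2.1, ω.1, ω.2.2.2.2.2.1, ω.2.1, ω.2.2.1)) ∧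
    r.2.2.1 ≤ cmiOf (hkJoint fx fw s pU ch) (fun ω => ω.2.2.2.2.2.1) (fun ω => ω.2.2.2.2.2.2.2.2.1) (fun ω => (ω.2.2.2.1, ω.1))}

/-- Receiver-1 successive-cancellation region for layer order λ = 4:
`S1 → S2 → T1 → S3 → U → T2`. -/
def R1L4 (fx : 𝒮 → 𝒯 → 𝒳) (fw : 𝒰 → 𝒱 → 𝒲) (s : HKSplit 𝒮 𝒯 𝒰 𝒱) (pU : 𝒰 → ℝ)
    (ch : 𝒳 → 𝒲 → 𝒴₁ → 𝒴₂ → ℝ) : Set (ℝ × ℝ × ℝ × ℝ) :=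
  {r | 0 ≤ r.1 ∧ 0 ≤ r.2.1 ∧ 0 ≤ r.2.2.1 ∧ 0 ≤ r.2.2.2 ∧
    r.1 ≤ miOf (hkJoint fx fw s pU ch) (fun ω => ω.1) (fun ω => ω.2.2.2.2.2.2.2.2.1)
        + cmiOf (hkJoint fx fw s pU ch) (fun ω => ω.2.1) (fun ω => ω.2.2.2.2.2.2.2.2.1) (fun ω => (ω.1))
        + cmiOf (hkJoint fx fw s pU ch) (fun ω => ω.2.2.1) (fun ω => ω.2.2.2.2.2.2.2.2.1) (fun ω => (ω.1, ω.2.1, ω.2.2.2.1)) ∧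
    r.2.1 ≤ cmiOf (hkJoint fx fw s pU ch) (fun ω => ω.2.2.2.1) (fun ω => ω.2.2.2.2.2.2.2.2.1) (fun ω => (ω.1, ω.2.1))
        + cmiOf (hkJoint fx fw s pU ch) (fun ω => ω.2.2.2.2.1) (fun ω => ω.2.2.2.2.2.2.2.2.1) (fun ω => (ω.1, ω.2.1, ω.2.2.2.1, ω.2.2.1, ω.2.2.2.2.2.1)) ∧
    r.2.2.1 ≤ cmiOf (hkJoint fx fw s pU ch) (fun ω => ω.2.2.2.2.2.1) (fun ω => ω.2.2.2.2.2.2.2.2.1) (fun ω => (ω.1, ω.2.1, ω.2.2.2.1, ω.2.2.1))}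

/-- Receiver-1 successive-cancellation region for layer order λ = 5:
`T1 → U → S1 → S2 → T2 → S3`. -/
def R1L5 (fx : 𝒮 → 𝒯 → 𝒳) (fw : 𝒰 → 𝒱 → 𝒲) (s : HKSplit 𝒮 𝒯 𝒰 𝒱) (pU : 𝒰 → ℝ)
    (ch : 𝒳 → 𝒲 → 𝒴₁ → 𝒴₂ → ℝ) : Set (ℝ × ℝ × ℝ × ℝ) :=
  {r | 0 ≤ r.1 ∧ 0 ≤ r.2.1 ∧ 0 ≤ r.2.2.1 ∧ 0 ≤ r.2.2.2 ∧
    r.1 ≤ cmiOf (hkJoint fx fw s pU ch) (fun ω => ω.1) (fun ω => ω.2.2.2.2.2.2.2.2.1) (fun ω => (ω.2.2.2.1, ω.2.2.2.2.2.1))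
        + cmiOf (hkJoint fx fw s pU ch) (fun ω => ω.2.1) (fun ω => ω.2.2.2.2.2.2.2.2.1) (fun ω => (ω.2.2.2.1, ω.2.2.2.2.2.1, ω.1))
        + cmiOf (hkJoint fx fw s pU ch) (fun ω => ω.2.2.1) (fun ω => ω.2.2.2.2.2.2.2.2.1) (fun ω => (ω.2.2.2.1, ω.2.2.2.2.2.1, ω.1, ω.2.1, ω.2.2.2.2.1)) ∧
    r.2.1 ≤ miOf (hkJoint fx fw s pU ch) (fun ω => ω.2.2.2.1) (fun ω => ω.2.2.2.2.2.2.2.2.1)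
        + cmiOf (hkJoint fx fw s pU ch) (fun ω => ω.2.2.2.2.1) (fun ω => ω.2.2.2.2.2.2.2.2.1) (fun ω => (ω.2.2.2.1, ω.2.2.2.2.2.1, ω.1, ω.2.1)) ∧
    r.2.2.1 ≤ cmiOf (hkJoint fx fw s pU ch) (fun ω => ω.2.2.2.2.2.1) (fun ω => ω.2.2.2.2.2.2.2.2.1) (fun ω => (ω.2.2.2.1))}

/-- Receiver-1 successive-cancellation region for layer order λ = 6:
`T1 → S1 → S2 → U → S3 → T2`. -/
def R1L6 (fx : 𝒮 → 𝒯 → 𝒳) (fw : 𝒰 → 𝒱 → 𝒲) (s : HKSplit 𝒮 𝒯 𝒰 𝒱) (pU : 𝒰 → ℝ)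
    (ch : 𝒳 → 𝒲 → 𝒴₁ → 𝒴₂ → ℝ) : Set (ℝ × ℝ × ℝ × ℝ) :=
  {r | 0 ≤ r.1 ∧ 0 ≤ r.2.1 ∧ 0 ≤ r.2.2.1 ∧ 0 ≤ r.2.2.2 ∧
    r.1 ≤ cmiOf (hkJoint fx fw s pU ch) (fun ω => ω.1) (fun ω => ω.2.2.2.2.2.2.2.2.1) (fun ω => (ω.2.2.2.1))
        + cmiOf (hkJoint fx fw s pU ch) (fun ω => ω.2.1) (fun ω => ω.2.2.2.2.2.2.2.2.1) (fun ω => (ω.2.2.2.1, ω.1))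
        + cmiOf (hkJoint fx fw s pU ch) (fun ω => ω.2.2.1) (fun ω => ω.2.2.2.2.2.2.2.2.1) (fun ω => (ω.2.2.2.1, ω.1, ω.2.1, ω.2.2.2.2.2.1)) ∧
    r.2.1 ≤ miOf (hkJoint fx fw s pU ch) (fun ω => ω.2.2.2.1) (fun ω => ω.2.2.2.2.2.2.2.2.1)
        + cmiOf (hkJoint fx fw s pU ch) (fun ω => ω.2.2.2.2.1) (fun ω => ω.2.2.2.2.2.2.2.2.1) (fun ω => (ω.2.2.2.1, ω.1, ω.2.1, ω.2.2.2.2.2.1, ω.2.2.1)) ∧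
    r.2.2.1 ≤ cmiOf (hkJoint fx fw s pU ch) (fun ω => ω.2.2.2.2.2.1) (fun ω => ω.2.2.2.2.2.2.2.2.1) (fun ω => (ω.2.2.2.1, ω.1, ω.2.1))}

/-- Receiver-2 successive-cancellation region for layer order λ = 7:
`S1 → V1 → S2 → S3 → U → V2`. -/
def R2L7 (fx : 𝒮 → 𝒯 → 𝒳) (fw : 𝒰 → 𝒱 → 𝒲) (s : HKSplit 𝒮 𝒯 𝒰 𝒱) (pU : 𝒰 → ℝ)
    (ch : 𝒳 → 𝒲 → 𝒴₁ → 𝒴₂ → ℝ) : Set (ℝ × ℝ × ℝ × ℝ) :=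
  {r | 0 ≤ r.1 ∧ 0 ≤ r.2.1 ∧ 0 ≤ r.2.2.1 ∧ 0 ≤ r.2.2.2 ∧
    r.1 ≤ miOf (hkJoint fx fw s pU ch) (fun ω => ω.1) (fun ω => ω.2.2.2.2.2.2.2.2.2)
        + cmiOf (hkJoint fx fw s pU ch) (fun ω => ω.2.1) (fun ω => ω.2.2.2.2.2.2.2.2.2) (fun ω => (ω.1, ω.2.2.2.2.2.2.1))
        + cmiOf (hkJoint fx fw s pU ch) (fun ω => ω.2.2.1) (fun ω => ω.2.2.2.2.2.2.2.2.2) (fun ω => (ω.1, ω.2.2.2.2.2.2.1, ω.2.1)) ∧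
    r.2.2.2 ≤ cmiOf (hkJoint fx fw s pU ch) (fun ω => ω.2.2.2.2.2.2.1) (fun ω => ω.2.2.2.2.2.2.2.2.2) (fun ω => (ω.1))
        + cmiOf (hkJoint fx fw s pU ch) (fun ω => ω.2.2.2.2.2.2.2.1) (fun ω => ω.2.2.2.2.2.2.2.2.2) (fun ω => (ω.1, ω.2.2.2.2.2.2.1, ω.2.1, ω.2.2.1, ω.2.2.2.2.2.1)) ∧
    r.2.2.1 ≤ cmiOf (hkJoint fx fw s pU ch) (fun ω => ω.2.2.2.2.2.1) (fun ω => ω.2.2.2.2.2.2.2.2.2) (fun ω => (ω.1, ω.2.2.2.2.2.2.1, ω.2.1, ω.2.2.1))}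

/-- Receiver-2 successive-cancellation region for layer order λ = 8:
`V1 → U → S1 → V2 → S2 → S3`. -/
def R2L8 (fx : 𝒮 → 𝒯 → 𝒳) (fw : 𝒰 → 𝒱 → 𝒲) (s : HKSplit 𝒮 𝒯 𝒰 𝒱) (pU : 𝒰 → ℝ)
    (ch : 𝒳 → 𝒲 → 𝒴₁ → 𝒴₂ → ℝ) : Set (ℝ × ℝ × ℝ × ℝ) :=
  {r | 0 ≤ r.1 ∧ 0 ≤ r.2.1 ∧ 0 ≤ r.2.2.1 ∧ 0 ≤ r.2.2.2 ∧
    r.1 ≤ cmiOf (hkJoint fx fw s pU ch) (fun ω => ω.1) (fun ω => ω.2.2.2.2.2.2.2.2.2) (fun ω => (ω.2.2.2.2.2.2.1, ω.2.2.2.2.2.1))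
        + cmiOf (hkJoint fx fw s pU ch) (fun ω => ω.2.1) (fun ω => ω.2.2.2.2.2.2.2.2.2) (fun ω => (ω.2.2.2.2.2.2.1, ω.2.2.2.2.2.1, ω.1, ω.2.2.2.2.2.2.2.1))
        + cmiOf (hkJoint fx fw s pU ch) (fun ω => ω.2.2.1) (fun ω => ω.2.2.2.2.2.2.2.2.2) (fun ω => (ω.2.2.2.2.2.2.1, ω.2.2.2.2.2.1, ω.1, ω.2.2.2.2.2.2.2.1, ω.2.1)) ∧
    r.2.2.2 ≤ miOf (hkJoint fx fw s pU ch) (fun ω => ω.2.2.2.2.2.2.1) (fun ω => ω.2.2.2.2.2.2.2.2.2)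
        + cmiOf (hkJoint fx fw s pU ch) (fun ω => ω.2.2.2.2.2.2.2.1) (fun ω => ω.2.2.2.2.2.2.2.2.2) (fun ω => (ω.2.2.2.2.2.2.1, ω.2.2.2.2.2.1, ω.1)) ∧
    r.2.2.1 ≤ cmiOf (hkJoint fx fw s pU ch) (fun ω => ω.2.2.2.2.2.1) (fun ω => ω.2.2.2.2.2.2.2.2.2) (fun ω => (ω.2.2.2.2.2.2.1))}

/-- Receiver-2 successive-cancellation region for layer order λ = 9:
`V1 → S1 → U → S2 → S3 → V2`. -/
def R2L9 (fx : 𝒮 → 𝒯 → 𝒳) (fw : 𝒰 → 𝒱 → 𝒲) (s : HKSplit 𝒮 𝒯 𝒰 𝒱) (pU : 𝒰 → ℝ)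
    (ch : 𝒳 → 𝒲 → 𝒴₁ → 𝒴₂ → ℝ) : Set (ℝ × ℝ × ℝ × ℝ) :=
  {r | 0 ≤ r.1 ∧ 0 ≤ r.2.1 ∧ 0 ≤ r.2.2.1 ∧ 0 ≤ r.2.2.2 ∧
    r.1 ≤ cmiOf (hkJoint fx fw s pU ch) (fun ω => ω.1) (fun ω => ω.2.2.2.2.2.2.2.2.2) (fun ω => (ω.2.2.2.2.2.2.1))
        + cmiOf (hkJoint fx fw s pU ch) (fun ω => ω.2.1) (fun ω => ω.2.2.2.2.2.2.2.2.2) (fun ω => (ω.2.2.2.2.2.2.1, ω.1, ω.2.2.2.2.2.1))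
        + cmiOf (hkJoint fx fw s pU ch) (fun ω => ω.2.2.1) (fun ω => ω.2.2.2.2.2.2.2.2.2) (fun ω => (ω.2.2.2.2.2.2.1, ω.1, ω.2.2.2.2.2.1, ω.2.1)) ∧
    r.2.2.2 ≤ miOf (hkJoint fx fw s pU ch) (fun ω => ω.2.2.2.2.2.2.1) (fun ω => ω.2.2.2.2.2.2.2.2.2)
        + cmiOf (hkJoint fx fw s pU ch) (fun ω => ω.2.2.2.2.2.2.2.1) (fun ω => ω.2.2.2.2.2.2.2.2.2) (fun ω => (ω.2.2.2.2.2.2.1, ω.1, ω.2.2.2.2.2.1, ω.2.1, ω.2.2.1)) ∧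
    r.2.2.1 ≤ cmiOf (hkJoint fx fw s pU ch) (fun ω => ω.2.2.2.2.2.1) (fun ω => ω.2.2.2.2.2.2.2.2.2) (fun ω => (ω.2.2.2.2.2.2.1, ω.1))}

/-- Receiver-2 successive-cancellation region for layer order λ = 10:
`S1 → S2 → V1 → S3 → U → V2`. -/
def R2L10 (fx : 𝒮 → 𝒯 → 𝒳) (fw : 𝒰 → 𝒱 → 𝒲) (s : HKSplit 𝒮 𝒯 𝒰 𝒱) (pU : 𝒰 → ℝ)
    (ch : 𝒳 → 𝒲 → 𝒴₁ → 𝒴₂ → ℝ) : Set (ℝ × ℝ × ℝ × ℝ) :=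
  {r | 0 ≤ r.1 ∧ 0 ≤ r.2.1 ∧ 0 ≤ r.2.2.1 ∧ 0 ≤ r.2.2.2 ∧
    r.1 ≤ miOf (hkJoint fx fw s pU ch) (fun ω => ω.1) (fun ω => ω.2.2.2.2.2.2.2.2.2)
        + cmiOf (hkJoint fx fw s pU ch) (fun ω => ω.2.1) (fun ω => ω.2.2.2.2.2.2.2.2.2) (fun ω => (ω.1))
        + cmiOf (hkJoint fx fw s pU ch) (fun ω => ω.2.2.1) (fun ω => ω.2.2.2.2.2.2.2.2.2) (fun ω => (ω.1, ω.2.1, ω.2.2.2.2.2.2.1)) ∧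
    r.2.2.2 ≤ cmiOf (hkJoint fx fw s pU ch) (fun ω => ω.2.2.2.2.2.2.1) (fun ω => ω.2.2.2.2.2.2.2.2.2) (fun ω => (ω.1, ω.2.1))
        + cmiOf (hkJoint fx fw s pU ch) (fun ω => ω.2.2.2.2.2.2.2.1) (fun ω => ω.2.2.2.2.2.2.2.2.2) (fun ω => (ω.1, ω.2.1, ω.2.2.2.2.2.2.1, ω.2.2.1, ω.2.2.2.2.2.1)) ∧
    r.2.2.1 ≤ cmiOf (hkJoint fx fw s pU ch) (fun ω => ω.2.2.2.2.2.1) (fun ω => ω.2.2.2.2.2.2.2.2.2) (fun ω => (ω.1, ω.2.1, ω.2.2.2.2.2.2.1, ω.2.2.1))}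

/-- Receiver-2 successive-cancellation region for layer order λ = 11:
`V1 → U → S1 → S2 → V2 → S3`. -/
def R2L11 (fx : 𝒮 → 𝒯 → 𝒳) (fw : 𝒰 → 𝒱 → 𝒲) (s : HKSplit 𝒮 𝒯 𝒰 𝒱) (pU : 𝒰 → ℝ)
    (ch : 𝒳 → 𝒲 → 𝒴₁ → 𝒴₂ → ℝ) : Set (ℝ × ℝ × ℝ × ℝ) :=
  {r | 0 ≤ r.1 ∧ 0 ≤ r.2.1 ∧ 0 ≤ r.2.2.1 ∧ 0 ≤ r.2.2.2 ∧
    r.1 ≤ cmiOf (hkJoint fx fw s pU ch) (fun ω => ω.1) (fun ω => ω.2.2.2.2.2.2.2.2.2) (fun ω => (ω.2.2.2.2.2.2.1, ω.2.2.2.2.2.1))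
        + cmiOf (hkJoint fx fw s pU ch) (fun ω => ω.2.1) (fun ω => ω.2.2.2.2.2.2.2.2.2) (fun ω => (ω.2.2.2.2.2.2.1, ω.2.2.2.2.2.1, ω.1))
        + cmiOf (hkJoint fx fw s pU ch) (fun ω => ω.2.2.1) (fun ω => ω.2.2.2.2.2.2.2.2.2) (fun ω => (ω.2.2.2.2.2.2.1, ω.2.2.2.2.2.1, ω.1, ω.2.1, ω.2.2.2.2.2.2.2.1)) ∧
    r.2.2.2 ≤ miOf (hkJoint fx fw s pU ch) (fun ω => ω.2.2.2.2.2.2.1) (fun ω => ω.2.2.2.2.2.2.2.2.2)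
        + cmiOf (hkJoint fx fw s pU ch) (fun ω => ω.2.2.2.2.2.2.2.1) (fun ω => ω.2.2.2.2.2.2.2.2.2) (fun ω => (ω.2.2.2.2.2.2.1, ω.2.2.2.2.2.1, ω.1, ω.2.1)) ∧
    r.2.2.1 ≤ cmiOf (hkJoint fx fw s pU ch) (fun ω => ω.2.2.2.2.2.1) (fun ω => ω.2.2.2.2.2.2.2.2.2) (fun ω => (ω.2.2.2.2.2.2.1))}

/-- Receiver-2 successive-cancellation region for layer order λ = 12:
`V1 → S1 → S2 → U → S3 → V2`. -/
def R2L12 (fx : 𝒮 → 𝒯 → 𝒳) (fw : 𝒰 → 𝒱 → 𝒲) (s : HKSplit 𝒮 𝒯 𝒰 𝒱) (pU : 𝒰 → ℝ)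
    (ch : 𝒳 → 𝒲 → 𝒴₁ → 𝒴₂ → ℝ) : Set (ℝ × ℝ × ℝ × ℝ) :=
  {r | 0 ≤ r.1 ∧ 0 ≤ r.2.1 ∧ 0 ≤ r.2.2.1 ∧ 0 ≤ r.2.2.2 ∧
    r.1 ≤ cmiOf (hkJoint fx fw s pU ch) (fun ω => ω.1) (fun ω => ω.2.2.2.2.2.2.2.2.2) (fun ω => (ω.2.2.2.2.2.2.1))
        + cmiOf (hkJoint fx fw s pU ch) (fun ω => ω.2.1) (fun ω => ω.2.2.2.2.2.2.2.2.2) (fun ω => (ω.2.2.2.2.2.2.1, ω.1))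
        + cmiOf (hkJoint fx fw s pU ch) (fun ω => ω.2.2.1) (fun ω => ω.2.2.2.2.2.2.2.2.2) (fun ω => (ω.2.2.2.2.2.2.1, ω.1, ω.2.1, ω.2.2.2.2.2.1)) ∧
    r.2.2.2 ≤ miOf (hkJoint fx fw s pU ch) (fun ω => ω.2.2.2.2.2.2.1) (fun ω => ω.2.2.2.2.2.2.2.2.2)
        + cmiOf (hkJoint fx fw s pU ch) (fun ω => ω.2.2.2.2.2.2.2.1) (fun ω => ω.2.2.2.2.2.2.2.2.2) (fun ω => (ω.2.2.2.2.2.2.1, ω.1, ω.2.1, ω.2.2.2.2.2.1, ω.2.2.1)) ∧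
    r.2.2.1 ≤ cmiOf (hkJoint fx fw s pU ch) (fun ω => ω.2.2.2.2.2.1) (fun ω => ω.2.2.2.2.2.2.2.2.2) (fun ω => (ω.2.2.2.2.2.2.1, ω.1, ω.2.1))}

/-- The six layer orders at receiver 1 (λ₁ = 1,…,6). -/
inductive HKOrder1 | o1 | o2 | o3 | o4 | o5 | o6

/-- The six layer orders at receiver 2 (λ₂ = 7,…,12). -/
inductive HKOrder2 | o7 | o8 | o9 | o10 | o11 | o12

/-- `𝓡₁(p',λ₁)` for a layer order `λ₁` at receiver 1. -/
def R1Reg (fx : 𝒮 → 𝒯 → 𝒳) (fw : 𝒰 → 𝒱 → 𝒲) (s : HKSplit 𝒮 𝒯 𝒰 𝒱) (pU : 𝒰 → ℝ)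
    (ch : 𝒳 → 𝒲 → 𝒴₁ → 𝒴₂ → ℝ) : HKOrder1 → Set (ℝ × ℝ × ℝ × ℝ)
  | .o1 => R1L1 fx fw s pU ch
  | .o2 => R1L2 fx fw s pU ch
  | .o3 => R1L3 fx fw s pU ch
  | .o4 => R1L4 fx fw s pU ch
  | .o5 => R1L5 fx fw s pU ch
  | .o6 => R1L6 fx fw s pU ch

/-- `𝓡₂(p',λ₂)` for a layer order `λ₂` at receiver 2. -/
def R2Reg (fx : 𝒮 → 𝒯 → 𝒳) (fw : 𝒰 → 𝒱 → 𝒲) (s : HKSplit 𝒮 𝒯 𝒰 𝒱) (pU : 𝒰 → ℝ)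
    (ch : 𝒳 → 𝒲 → 𝒴₁ → 𝒴₂ → ℝ) : HKOrder2 → Set (ℝ × ℝ × ℝ × ℝ)
  | .o7 => R2L7 fx fw s pU ch
  | .o8 => R2L8 fx fw s pU ch
  | .o9 => R2L9 fx fw s pU ch
  | .o10 => R2L10 fx fw s pU ch
  | .o11 => R2L11 fx fw s pU ch
  | .o12 => R2L12 fx fw s pU ch

set_option linter.unusedSectionVars false

namespace HanKobayashi

/-- A finitely supported average of a functional of laws. -/
def avg {A S : Type*} [Fintype A] (p : A → ℝ) (κ : A → S → ℝ) (F : (S → ℝ) → ℝ) : ℝ :=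
  ∑ a, p a * F (κ a)

/-- The point mass at `s`. -/
def pointMass {S : Type*} (s : S) : S → ℝ := fun s' => if s = s' then 1 else 0

/-- Conditional entropy `H(Y|Z)`. -/
def condEnt {Ω ζ Y : Type*} [Fintype Ω] [Fintype ζ] [Fintype Y]
    (q : Ω → ℝ) (Z : Ω → ζ) (y : Ω → Y) : ℝ :=
  Hof q (fun ω => (Z ω, y ω)) - Hof q Z

section Entropy

variable {Ω α β γ ζ Y : Type*} [Fintype Ω] [Fintype α] [Fintype β] [Fintype γ] [Fintype ζ]
  [Fintype Y]

theorem sum_pushf_mul (q : Ω → ℝ) (f : Ω → β) (G : β → ℝ) :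
    ∑ b, pushf q f b * G b = ∑ ω, q ω * G (f ω) := by
  simp only [pushf, Finset.sum_mul, ite_mul, zero_mul]
  rw [Finset.sum_comm]
  simp

theorem pushf_eq_sum_mul (q : Ω → ℝ) (f : Ω → β) (b : β) :
    pushf q f b = ∑ ω, q ω * (if f ω = b then 1 else 0) := by
  simp [pushf]

theorem pushf_pushf (q : Ω → ℝ) (f : Ω → β) (g : β → γ) :
    pushf (pushf q f) g = pushf q (fun ω => g (f ω)) := by
  funext c
  rw [pushf_eq_sum_mul, pushf_eq_sum_mul]
  exact sum_pushf_mul q f (fun b => if g b = c then 1 else 0)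

theorem sum_pushf (q : Ω → ℝ) (f : Ω → β) : ∑ b, pushf q f b = ∑ ω, q ω := by
  simpa using sum_pushf_mul q f (fun _ => 1)

theorem pushf_eq_sum_of_equiv {B R : Type*} [Fintype B] [Fintype R] (q : Ω → ℝ) (π : Ω → B)
    (e : B × R ≃ Ω) (h : ∀ x, π (e x) = x.1) (b : B) :
    pushf q π b = ∑ r, q (e (b, r)) := by
  unfold pushf
  rw [← e.sum_comp, Fintype.sum_prod_type]
  simp only [h]
  rw [Finset.sum_eq_single b]
  · simp
  · intro b' _ hb
    simp [hb]
  · simp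

theorem Hof_congr (q : Ω → ℝ) (f : Ω → β) (g : Ω → γ)
    (h : ∀ ω ω', f ω = f ω' ↔ g ω = g ω') : Hof q f = Hof q g := by
  unfold Hof ent
  rw [sum_pushf_mul q f (fun b => Real.log (pushf q f b)),
    sum_pushf_mul q g (fun b => Real.log (pushf q g b))]
  have hp : ∀ ω, pushf q f (f ω) = pushf q g (g ω) := by
    intro ω
    unfold pushf
    refine Finset.sum_congr rfl fun ω' _ => ?_
    simp only [h]
  simp only [hp]

theorem Hof_comp (q : Ω → ℝ) (π : Ω → β) (X : β → γ) :
    Hof q (fun ω => X (π ω)) = Hof (pushf q π) X := by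
  unfold Hof
  rw [pushf_pushf]

theorem condEnt_congr (q : Ω → ℝ) (Z : Ω → β) (Z' : Ω → γ) (y : Ω → Y)
    (h : ∀ ω ω', Z ω = Z ω' ↔ Z' ω = Z' ω') : condEnt q Z y = condEnt q Z' y := by
  unfold condEnt
  rw [Hof_congr q Z Z' h, Hof_congr q (fun ω => (Z ω, y ω)) (fun ω => (Z' ω, y ω))]
  intro ω ω'
  simp [h]

theorem condEnt_comp (q : Ω → ℝ) (π : Ω → β) (Z : β → γ) (y : β → Y) :
    condEnt q (fun ω => Z (π ω)) (fun ω => y (π ω)) = condEnt (pushf q π) Z y := by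
  unfold condEnt
  rw [Hof_comp q π Z, Hof_comp q π (fun b => (Z b, y b))]

theorem cmiOf_eq_condEnt_sub (q : Ω → ℝ) (A : Ω → α) (y : Ω → Y) (C : Ω → γ) :
    cmiOf q A y C = condEnt q C y - condEnt q (fun ω => (A ω, C ω)) y := by
  unfold cmiOf condEnt
  rw [Hof_congr q (fun ω => (y ω, C ω)) (fun ω => (C ω, y ω)) (by simp; tauto),
    Hof_congr q (fun ω => (A ω, y ω, C ω)) (fun ω => ((A ω, C ω), y ω)) (by simp; tauto)]
  ring

theorem miOf_eq_condEnt_sub (q : Ω → ℝ) (hq : ∑ ω, q ω = 1) (A : Ω → α) (y : Ω → Y) :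
    miOf q A y = condEnt q (fun _ => ()) y - condEnt q A y := by
  unfold miOf condEnt
  have h0 : Hof q (fun _ => ()) = 0 := by
    simp [Hof, ent, pushf, hq]
  rw [Hof_congr q (fun ω => ((), y ω)) y (by simp), h0]
  ring

theorem ent_mul_kernel (p : ζ → ℝ) (w : ζ → Y → ℝ) (hw : ∀ z, ∑ v, w z v = 1) :
    ent (fun x : ζ × Y => p x.1 * w x.1 x.2) = ent p + ∑ z, p z * ent (w z) := by
  unfold ent
  rw [Fintype.sum_prod_type, ← Finset.sum_neg_distrib, ← Finset.sum_neg_distrib,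
    ← Finset.sum_add_distrib]
  refine Finset.sum_congr rfl fun z _ => ?_
  have h : ∀ v, p z * w z v * Real.log (p z * w z v)
      = w z v * (p z * Real.log (p z)) + p z * (w z v * Real.log (w z v)) := by
    intro v
    by_cases hp : p z = 0
    · simp [hp]
    by_cases hv : w z v = 0
    · simp [hv]
    rw [Real.log_mul hp hv]
    ring
  simp only [h]
  rw [Finset.sum_add_distrib, ← Finset.sum_mul, ← Finset.mul_sum, hw]
  ring

/-- Submodularity of conditional entropy for independent inputs. -/
theorem ent_submodular (p : α → ℝ) (p' : β → ℝ) (hp : ∀ a, 0 ≤ p a) (hp' : ∀ b, 0 ≤ p' b)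
    (w : α → β → Y → ℝ) (hw : ∀ a b v, 0 ≤ w a b v) :
    ent (fun v => ∑ a, p a * ∑ b, p' b * w a b v) + ∑ a, p a * ∑ b, p' b * ent (w a b)
      ≤ (∑ a, p a * ent (fun v => ∑ b, p' b * w a b v))
        + ∑ b, p' b * ent (fun v => ∑ a, p a * w a b v) := by
  have key : ∀ v, 0 ≤ (∑ a, p a * ∑ b, p' b * w a b v) *
        Real.log (∑ a, p a * ∑ b, p' b * w a b v)
      + ∑ a, p a * ∑ b, p' b * (w a b v * Real.log (w a b v))
      - (∑ a, p a * ((∑ b, p' b * w a b v) * Real.log (∑ b, p' b * w a b v)))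
      - ∑ b, p' b * ((∑ a, p a * w a b v) * Real.log (∑ a, p a * w a b v)) := by
    intro v
    set r : α → ℝ := fun a => ∑ b, p' b * w a b v with hr
    set c : β → ℝ := fun b => ∑ a, p a * w a b v with hc
    set z : ℝ := ∑ a, p a * ∑ b, p' b * w a b v with hz
    have hr0 : ∀ a, 0 ≤ r a := fun a => Finset.sum_nonneg fun b _ => mul_nonneg (hp' b) (hw a b v)
    have hc0 : ∀ b, 0 ≤ c b := fun b => Finset.sum_nonneg fun a _ => mul_nonneg (hp a) (hw a b v)
    have hzr : z = ∑ a, p a * r a := rfl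
    have hz0 : 0 ≤ z := Finset.sum_nonneg fun a _ => mul_nonneg (hp a) (hr0 a)
    have hzc : z = ∑ b, p' b * c b := by
      simp only [hz, hc, Finset.mul_sum]
      rw [Finset.sum_comm]
      exact Finset.sum_congr rfl fun b _ => Finset.sum_congr rfl fun a _ => by ring
    have e1 : z * Real.log z = ∑ a, ∑ b, p a * p' b * w a b v * Real.log z := by
      simp only [hz, Finset.mul_sum, Finset.sum_mul]
      exact Finset.sum_congr rfl fun a _ => Finset.sum_congr rfl fun b _ => by ring
    have e2 : ∑ a, p a * ∑ b, p' b * (w a b v * Real.log (w a b v))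
        = ∑ a, ∑ b, p a * p' b * w a b v * Real.log (w a b v) := by
      simp only [Finset.mul_sum]
      exact Finset.sum_congr rfl fun a _ => Finset.sum_congr rfl fun b _ => by ring
    have e3 : ∑ a, p a * (r a * Real.log (r a))
        = ∑ a, ∑ b, p a * p' b * w a b v * Real.log (r a) := by
      refine Finset.sum_congr rfl fun a _ => ?_
      rw [← Finset.sum_mul]
      simp only [mul_assoc, ← Finset.mul_sum]
      rfl
    have e4 : ∑ b, p' b * (c b * Real.log (c b))
        = ∑ a, ∑ b, p a * p' b * w a b v * Real.log (c b) := by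
      rw [Finset.sum_comm]
      refine Finset.sum_congr rfl fun b _ => ?_
      rw [← Finset.sum_mul, ← mul_assoc]
      congr 1
      simp only [hc, Finset.mul_sum]
      exact Finset.sum_congr rfl fun a _ => by ring
    have e5 : ∑ a, ∑ b, (p a * p' b * w a b v - p a * p' b * (r a * c b / z)) = 0 := by
      simp only [Finset.sum_sub_distrib]
      have h1 : ∑ a, ∑ b, p a * p' b * w a b v = z := by
        simp only [hz, Finset.mul_sum, mul_assoc]
      have h2 : ∑ a, ∑ b, p a * p' b * (r a * c b / z) = z * z / z := by
        have h3 : z * z / z = (∑ a, p a * r a) * (∑ b, p' b * c b) / z := by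
          rw [← hzr, ← hzc]
        rw [h3, Finset.sum_mul_sum, Finset.sum_div]
        refine Finset.sum_congr rfl fun a _ => ?_
        rw [Finset.sum_div]
        exact Finset.sum_congr rfl fun b _ => by ring
      rw [h1, h2, mul_self_div_self, sub_self]
    rw [e1, e2, e3, e4, ← Finset.sum_add_distrib, ← Finset.sum_sub_distrib,
      ← Finset.sum_sub_distrib, ← e5]
    refine Finset.sum_le_sum fun a _ => ?_
    rw [← Finset.sum_add_distrib, ← Finset.sum_sub_distrib, ← Finset.sum_sub_distrib]
    refine Finset.sum_le_sum fun b _ => ?_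
    rcases (hp a).eq_or_lt with ha | ha
    · simp [← ha]
    rcases (hp' b).eq_or_lt with hb | hb
    · simp [← hb]
    rcases (hw a b v).eq_or_lt with hv | hv
    · have : 0 ≤ p a * p' b * (r a * c b / z) :=
        mul_nonneg (mul_nonneg (hp a) (hp' b)) (div_nonneg (mul_nonneg (hr0 a) (hc0 b)) hz0)
      simp only [← hv, mul_zero, zero_mul, zero_sub, sub_zero, add_zero]
      linarith
    have hra : 0 < r a := lt_of_lt_of_le (mul_pos hb hv)
      (Finset.single_le_sum (f := fun b => p' b * w a b v)
        (fun b _ => mul_nonneg (hp' b) (hw a b v)) (Finset.mem_univ b))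
    have hcb : 0 < c b := lt_of_lt_of_le (mul_pos ha hv)
      (Finset.single_le_sum (f := fun a => p a * w a b v)
        (fun a _ => mul_nonneg (hp a) (hw a b v)) (Finset.mem_univ a))
    have hzp : 0 < z := lt_of_lt_of_le (mul_pos ha hra)
      (Finset.single_le_sum (f := fun a => p a * r a)
        (fun a _ => mul_nonneg (hp a) (hr0 a)) (Finset.mem_univ a))
    have hlog := Real.log_le_sub_one_of_pos
      (div_pos (mul_pos hra hcb) (mul_pos hv hzp))
    rw [Real.log_div (mul_pos hra hcb).ne' (mul_pos hv hzp).ne', Real.log_mul hra.ne' hcb.ne',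
      Real.log_mul hv.ne' hzp.ne'] at hlog
    have hm := mul_le_mul_of_nonneg_left hlog (mul_pos (mul_pos ha hb) hv).le
    have hx : p a * p' b * w a b v * (r a * c b / (w a b v * z) - 1)
        = p a * p' b * (r a * c b / z) - p a * p' b * w a b v := by
      field_simp
    rw [hx] at hm
    linarith
  have hs := Finset.sum_nonneg fun v (_ : v ∈ Finset.univ) => key v
  simp only [Finset.sum_sub_distrib, Finset.sum_add_distrib] at hs
  have f1 : ∑ v, ∑ a, p a * ∑ b, p' b * (w a b v * Real.log (w a b v))
      = ∑ a, p a * ∑ b, p' b * ∑ v, w a b v * Real.log (w a b v) := by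
    simp only [Finset.mul_sum]
    rw [Finset.sum_comm]
    exact Finset.sum_congr rfl fun a _ => Finset.sum_comm
  rw [f1, Finset.sum_comm (s := (Finset.univ : Finset Y)) (t := (Finset.univ : Finset α)),
    Finset.sum_comm (s := (Finset.univ : Finset Y)) (t := (Finset.univ : Finset β))] at hs
  simp only [← Finset.mul_sum] at hs
  simp only [ent, mul_neg, Finset.sum_neg_distrib]
  linarith

end Entropy

section Model

variable {S T U A B C Ωσ Ωτ Ωυ Y : Type*} [Fintype S] [Fintype T] [Fintype U] [Fintype A]
  [Fintype B] [Fintype C] [Fintype Ωσ] [Fintype Ωτ] [Fintype Ωυ] [Fintype Y]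

/-- Output law when the inputs `S, T, U` are independent with laws `μ, ν, ρ`. -/
def outLaw (W : S → T → U → Y → ℝ) (μ : S → ℝ) (ν : T → ℝ) (ρ : U → ℝ) : Y → ℝ :=
  fun v => ∑ s, μ s * ∑ t, ν t * ∑ u, ρ u * W s t u v

/-- Conditional entropy of the output when the three inputs are observed through the averaging
functionals `E`, `F`, `G`. -/
def obsEnt (W : S → T → U → Y → ℝ) (E : ((S → ℝ) → ℝ) → ℝ) (F : ((T → ℝ) → ℝ) → ℝ)
    (G : ((U → ℝ) → ℝ) → ℝ) : ℝ :=
  E fun μ => F fun ν => G fun ρ => ent (outLaw W μ ν ρ)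

/-- Joint law of three independent layers and the output of the channel they drive. -/
def model (pσ : Ωσ → ℝ) (fs : Ωσ → S) (pτ : Ωτ → ℝ) (ft : Ωτ → T) (pυ : Ωυ → ℝ) (fu : Ωυ → U)
    (W : S → T → U → Y → ℝ) : Ωσ × Ωτ × Ωυ × Y → ℝ :=
  fun x => pσ x.1 * pτ x.2.1 * pυ x.2.2.1 * W (fs x.1) (ft x.2.1) (fu x.2.2.1) x.2.2.2

/-- The variable `α σ` has law `p`, and `κ` is the conditional law of `fs σ` given `α σ`. -/
def Realizes (pσ : Ωσ → ℝ) (fs : Ωσ → S) (α : Ωσ → A) (p : A → ℝ) (κ : A → S → ℝ) : Prop :=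
  (∀ x, ∑ s, κ x s = 1) ∧
    ∀ x (G : S → ℝ), ∑ σ, (if α σ = x then pσ σ * G (fs σ) else 0) = p x * ∑ s, κ x s * G s

theorem sum_outLaw {W : S → T → U → Y → ℝ} (hW : ∀ s t u, ∑ v, W s t u v = 1)
    {μ : S → ℝ} {ν : T → ℝ} {ρ : U → ℝ} (hμ : ∑ s, μ s = 1) (hν : ∑ t, ν t = 1)
    (hρ : ∑ u, ρ u = 1) : ∑ v, outLaw W μ ν ρ v = 1 := by
  unfold outLaw
  rw [Finset.sum_comm, ← hμ]
  refine Finset.sum_congr rfl fun s _ => ?_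
  rw [← Finset.mul_sum, Finset.sum_comm]
  simp only [← Finset.mul_sum]
  rw [show ∑ t, ν t * ∑ v, ∑ u, ρ u * W s t u v = ∑ t, ν t from ?_, hν, mul_one]
  refine Finset.sum_congr rfl fun t _ => ?_
  rw [Finset.sum_comm]
  simp only [← Finset.mul_sum, hW, mul_one, hρ]

theorem pushf_model {pσ : Ωσ → ℝ} {fs : Ωσ → S} {pτ : Ωτ → ℝ} {ft : Ωτ → T} {pυ : Ωυ → ℝ}
    {fu : Ωυ → U} (W : S → T → U → Y → ℝ) {α : Ωσ → A} {β : Ωτ → B} {γ : Ωυ → C}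
    {pA : A → ℝ} {κA : A → S → ℝ} {pB : B → ℝ} {κB : B → T → ℝ} {pC : C → ℝ} {κC : C → U → ℝ}
    (hα : Realizes pσ fs α pA κA) (hβ : Realizes pτ ft β pB κB) (hγ : Realizes pυ fu γ pC κC) :
    pushf (model pσ fs pτ ft pυ fu W)
        (fun x => ((α x.1, β x.2.1, γ x.2.2.1), x.2.2.2))
      = fun x => (pA x.1.1 * pB x.1.2.1 * pC x.1.2.2) *
          outLaw W (κA x.1.1) (κB x.1.2.1) (κC x.1.2.2) x.2 := by
  funext ⟨⟨a, b, c⟩, v⟩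
  simp only [pushf, model, outLaw, Fintype.sum_prod_type, Prod.mk.injEq]
  have h1 : ∀ σ τ υ, ∑ v', (if (α σ = a ∧ β τ = b ∧ γ υ = c) ∧ v' = v then
      pσ σ * pτ τ * pυ υ * W (fs σ) (ft τ) (fu υ) v' else 0)
      = if α σ = a then pσ σ * (if β τ = b then pτ τ *
          (if γ υ = c then pυ υ * W (fs σ) (ft τ) (fu υ) v else 0) else 0) else 0 := by
    intro σ τ υ
    rw [Finset.sum_eq_single v]
    · by_cases h1 : α σ = a <;> by_cases h2 : β τ = b <;> by_cases h3 : γ υ = c <;>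
        simp [h1, h2, h3, mul_assoc]
    · intro v' _ hv
      simp [hv]
    · simp
  simp only [h1]
  have h2 : ∀ σ τ, ∑ υ, (if α σ = a then pσ σ * (if β τ = b then pτ τ *
          (if γ υ = c then pυ υ * W (fs σ) (ft τ) (fu υ) v else 0) else 0) else 0)
      = if α σ = a then pσ σ * (if β τ = b then pτ τ *
          (pC c * ∑ u, κC c u * W (fs σ) (ft τ) u v) else 0) else 0 := by
    intro σ τ
    rw [← hγ.2 c (fun u => W (fs σ) (ft τ) u v)]
    by_cases h1 : α σ = a <;> by_cases h2 : β τ = b <;> simp [h1, h2, Finset.mul_sum]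
  simp only [h2]
  have h3 : ∀ σ, ∑ τ, (if α σ = a then pσ σ * (if β τ = b then pτ τ *
          (pC c * ∑ u, κC c u * W (fs σ) (ft τ) u v) else 0) else 0)
      = if α σ = a then pσ σ *
          (pB b * ∑ t, κB b t * (pC c * ∑ u, κC c u * W (fs σ) t u v)) else 0 := by
    intro σ
    rw [← hβ.2 b (fun t => pC c * ∑ u, κC c u * W (fs σ) t u v)]
    by_cases h1 : α σ = a <;> simp [h1, Finset.mul_sum]
  simp only [h3]
  rw [hα.2 a (fun s => pB b * ∑ t, κB b t * (pC c * ∑ u, κC c u * W s t u v))]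
  simp only [Finset.mul_sum]
  refine Finset.sum_congr rfl fun s _ => Finset.sum_congr rfl fun t _ =>
    Finset.sum_congr rfl fun u _ => by ring

theorem condEnt_model {pσ : Ωσ → ℝ} {fs : Ωσ → S} {pτ : Ωτ → ℝ} {ft : Ωτ → T} {pυ : Ωυ → ℝ}
    {fu : Ωυ → U} {W : S → T → U → Y → ℝ} (hW : ∀ s t u, ∑ v, W s t u v = 1)
    {α : Ωσ → A} {β : Ωτ → B} {γ : Ωυ → C}
    {pA : A → ℝ} {κA : A → S → ℝ} {pB : B → ℝ} {κB : B → T → ℝ} {pC : C → ℝ} {κC : C → U → ℝ}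
    (hα : Realizes pσ fs α pA κA) (hβ : Realizes pτ ft β pB κB) (hγ : Realizes pυ fu γ pC κC) :
    condEnt (model pσ fs pτ ft pυ fu W) (fun x => (α x.1, β x.2.1, γ x.2.2.1))
        (fun x => x.2.2.2) = obsEnt W (avg pA κA) (avg pB κB) (avg pC κC) := by
  have hs : ∀ z : A × B × C, ∑ v, outLaw W (κA z.1) (κB z.2.1) (κC z.2.2) v = 1 := fun z =>
    sum_outLaw hW (hα.1 _) (hβ.1 _) (hγ.1 _)
  have hm := pushf_model W hα hβ hγ
  have hz : pushf (model pσ fs pτ ft pυ fu W) (fun x => (α x.1, β x.2.1, γ x.2.2.1))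
      = fun z => pA z.1 * pB z.2.1 * pC z.2.2 := by
    rw [← pushf_pushf _ (fun x : Ωσ × Ωτ × Ωυ × Y => ((α x.1, β x.2.1, γ x.2.2.1), x.2.2.2))
      Prod.fst, hm]
    funext z
    rw [pushf_eq_sum_of_equiv _ _ (Equiv.refl _) (fun _ => rfl)]
    simp only [Equiv.refl_apply]
    rw [← Finset.mul_sum, hs, mul_one]
  unfold condEnt Hof
  rw [hm, hz, ent_mul_kernel (fun z : A × B × C => pA z.1 * pB z.2.1 * pC z.2.2)
    (fun z => outLaw W (κA z.1) (κB z.2.1) (κC z.2.2)) hs, add_sub_cancel_left]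
  simp only [obsEnt, avg, Fintype.sum_prod_type, Finset.mul_sum]
  refine Finset.sum_congr rfl fun s _ => Finset.sum_congr rfl fun t _ =>
    Finset.sum_congr rfl fun u _ => by ring

/-- The conditional entropy of `y` given any variable equivalent to `(α, β, γ)`. -/
theorem condEnt_eq_obsEnt {Ω ζ : Type*} [Fintype Ω] [Fintype ζ] {q : Ω → ℝ}
    {π : Ω → Ωσ × Ωτ × Ωυ × Y} {pσ : Ωσ → ℝ} {fs : Ωσ → S} {pτ : Ωτ → ℝ} {ft : Ωτ → T}
    {pυ : Ωυ → ℝ} {fu : Ωυ → U} {W : S → T → U → Y → ℝ} (hW : ∀ s t u, ∑ v, W s t u v = 1)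
    (hq : pushf q π = model pσ fs pτ ft pυ fu W)
    {pA : A → ℝ} {κA : A → S → ℝ} {pB : B → ℝ} {κB : B → T → ℝ} {pC : C → ℝ} {κC : C → U → ℝ}
    {α : Ωσ → A} {β : Ωτ → B} {γ : Ωυ → C}
    (hα : Realizes pσ fs α pA κA) (hβ : Realizes pτ ft β pB κB) (hγ : Realizes pυ fu γ pC κC)
    (Z : Ω → ζ) (hZ : ∀ ω ω', Z ω = Z ω' ↔ α (π ω).1 = α (π ω').1 ∧ β (π ω).2.1 = β (π ω').2.1 ∧
      γ (π ω).2.2.1 = γ (π ω').2.2.1) :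
    condEnt q Z (fun ω => (π ω).2.2.2) = obsEnt W (avg pA κA) (avg pB κB) (avg pC κC) := by
  rw [← condEnt_model hW hα hβ hγ, ← hq,
    ← condEnt_comp q π (fun x => (α x.1, β x.2.1, γ x.2.2.1)) (fun x => x.2.2.2)]
  exact condEnt_congr _ _ _ _ fun ω ω' => by simp only [hZ, Prod.mk.injEq]

/-- No observation of an input of law `p`. -/
def unobserved (p : S → ℝ) (F : (S → ℝ) → ℝ) : ℝ := F p

/-- Full observation of an input of law `p`. -/
def observed (p : S → ℝ) (F : (S → ℝ) → ℝ) : ℝ := ∑ s, p s * F (pointMass s)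

/-- Law of the input given the first layer, when it is recombined from two layers. -/
def layerLaw (pB : B → ℝ) (f : A → B → S) (a : A) : S → ℝ := fun s =>
  ∑ b, pB b * pointMass (f a b) s

/-- Observation of the first of two layers. -/
def layerObs (pA : A → ℝ) (pB : B → ℝ) (f : A → B → S) (F : (S → ℝ) → ℝ) : ℝ :=
  avg pA (layerLaw pB f) F

theorem sum_pointMass_mul (s : S) (G : S → ℝ) : ∑ s', pointMass s s' * G s' = G s := by
  simp [pointMass]

theorem sum_mul_pointMass (p : S → ℝ) (s' : S) : ∑ s, p s * pointMass s s' = p s' := by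
  simp [pointMass]

theorem sum_pointMass (s : S) : ∑ s', pointMass s s' = 1 := by
  simp [pointMass]

theorem avg_unit (p : S → ℝ) : avg (fun _ : Unit => 1) (fun _ => p) = unobserved p := by
  funext F
  simp [avg, unobserved]

theorem realizes_unit {pσ : Ωσ → ℝ} {fs : Ωσ → S} {p : S → ℝ} (hp : ∑ s, p s = 1)
    (h : pushf pσ fs = p) :
    Realizes pσ fs (fun _ => ()) (fun _ => 1) (fun _ => p) := by
  refine ⟨fun _ => hp, fun _ G => ?_⟩
  simp [← h, sum_pushf_mul]

theorem realizes_full (pσ : Ωσ → ℝ) (fs : Ωσ → S) :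
    Realizes pσ fs (fun σ => σ) pσ (fun σ => pointMass (fs σ)) := by
  refine ⟨fun _ => sum_pointMass _, fun x G => ?_⟩
  rw [sum_pointMass_mul]
  simp

theorem avg_full {pσ : Ωσ → ℝ} {fs : Ωσ → S} {p : S → ℝ} (h : pushf pσ fs = p) :
    avg pσ (fun σ => pointMass (fs σ)) = observed p := by
  funext F
  simp only [avg, observed, ← h]
  rw [sum_pushf_mul pσ fs (fun s => F (pointMass s))]

theorem sum_layerLaw_mul (pB : B → ℝ) (f : A → B → S) (a : A) (G : S → ℝ) :
    ∑ s, layerLaw pB f a s * G s = ∑ b, pB b * G (f a b) := by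
  simp only [layerLaw, Finset.sum_mul, mul_assoc]
  rw [Finset.sum_comm]
  simp only [← Finset.mul_sum, sum_pointMass_mul]

theorem realizes_layer (pA : A → ℝ) {pB : B → ℝ} (hB : ∑ b, pB b = 1) (f : A → B → S)
    (e : A × B ≃ Ωσ) {pσ : Ωσ → ℝ} {fs : Ωσ → S} {α : Ωσ → A}
    (hp : ∀ a b, pσ (e (a, b)) = pA a * pB b) (hf : ∀ a b, fs (e (a, b)) = f a b)
    (hα : ∀ a b, α (e (a, b)) = a) :
    Realizes pσ fs α pA (layerLaw pB f) := by
  constructor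
  · intro a
    simpa [hB] using sum_layerLaw_mul pB f a (fun _ => 1)
  · intro a G
    rw [sum_layerLaw_mul, ← e.sum_comp, Fintype.sum_prod_type, Finset.sum_eq_single a]
    · simp [hα, hp, hf, Finset.mul_sum, mul_assoc]
    · intro a' _ ha
      simp [hα, ha]
    · simp

end Model

section Refinement

variable {S T U Y : Type} [Fintype S] [Fintype T] [Fintype U] [Fintype Y]

theorem weighted_sum_comm {A B : Type*} [Fintype A] [Fintype B] (p : A → ℝ) (q : B → ℝ)
    (X : A → B → ℝ) : ∑ a, p a * ∑ b, q b * X a b = ∑ b, q b * ∑ a, p a * X a b := by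
  simp only [Finset.mul_sum]
  rw [Finset.sum_comm]
  exact Finset.sum_congr rfl fun b _ => Finset.sum_congr rfl fun a _ => by ring

/-- `E` is an average over finitely many nonnegative laws. -/
def IsAverage (E : ((S → ℝ) → ℝ) → ℝ) : Prop :=
  ∃ (A : Type) (_ : Fintype A) (p : A → ℝ) (κ : A → S → ℝ), (∀ a, 0 ≤ p a) ∧
    (∀ a s, 0 ≤ κ a s) ∧ E = avg p κ

/-- `E'` observes the input in finer detail than `E`, through one further independent layer. -/
def Refines (E E' : ((S → ℝ) → ℝ) → ℝ) : Prop :=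
  ∃ (A B : Type) (_ : Fintype A) (_ : Fintype B) (p : A → ℝ) (p' : B → ℝ) (κ : A → B → S → ℝ),
    (∀ a, 0 ≤ p a) ∧ (∀ b, 0 ≤ p' b) ∧ (∀ a b s, 0 ≤ κ a b s) ∧
    E = avg p (fun a s => ∑ b, p' b * κ a b s) ∧
    E' = fun F => ∑ a, p a * ∑ b, p' b * F (κ a b)

theorem Refines.isAverage_left {E E' : ((S → ℝ) → ℝ) → ℝ} (h : Refines E E') : IsAverage E := by
  obtain ⟨A, B, _, _, p, p', κ, hp, hp', hκ, hE, -⟩ := h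
  exact ⟨A, _, p, _, hp, fun a s => Finset.sum_nonneg fun b _ => mul_nonneg (hp' b) (hκ a b s), hE⟩

theorem Refines.isAverage_right {E E' : ((S → ℝ) → ℝ) → ℝ} (h : Refines E E') :
    IsAverage E' := by
  obtain ⟨A, B, _, _, p, p', κ, hp, hp', hκ, -, hE⟩ := h
  refine ⟨A × B, inferInstance, fun x => p x.1 * p' x.2, fun x => κ x.1 x.2,
    fun x => mul_nonneg (hp _) (hp' _), fun x => hκ _ _, ?_⟩
  funext F
  simp only [hE, avg, Fintype.sum_prod_type, Finset.mul_sum, mul_assoc]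

theorem IsAverage.mono {E : ((S → ℝ) → ℝ) → ℝ} (h : IsAverage E) {F G : (S → ℝ) → ℝ}
    (hFG : ∀ μ, (∀ s, 0 ≤ μ s) → F μ ≤ G μ) : E F ≤ E G := by
  obtain ⟨A, _, p, κ, hp, hκ, rfl⟩ := h
  exact Finset.sum_le_sum fun a _ => mul_le_mul_of_nonneg_left (hFG _ (hκ a)) (hp a)

theorem IsAverage.map_add {E : ((S → ℝ) → ℝ) → ℝ} (h : IsAverage E) (F G : (S → ℝ) → ℝ) :
    E (fun μ => F μ + G μ) = E F + E G := by
  obtain ⟨A, _, p, κ, -, -, rfl⟩ := h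
  simp only [avg, mul_add, Finset.sum_add_distrib]

theorem IsAverage.comm {E : ((S → ℝ) → ℝ) → ℝ} (hE : IsAverage E) {F : ((T → ℝ) → ℝ) → ℝ}
    (hF : IsAverage F) (X : (S → ℝ) → (T → ℝ) → ℝ) :
    E (fun μ => F fun ν => X μ ν) = F fun ν => E fun μ => X μ ν := by
  obtain ⟨A, _, p, κ, -, -, rfl⟩ := hE
  obtain ⟨B, _, p', κ', -, -, rfl⟩ := hF
  exact weighted_sum_comm _ _ _

/-- Conditional entropy is submodular in the observations of two independent inputs. -/
theorem Refines.ent_le {E E' : ((S → ℝ) → ℝ) → ℝ} {F F' : ((T → ℝ) → ℝ) → ℝ} (hE : Refines E E')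
    (hF : Refines F F') (M : S → T → Y → ℝ) (hM : ∀ s t v, 0 ≤ M s t v) :
    (E fun μ => F fun ν => ent fun v => ∑ s, μ s * ∑ t, ν t * M s t v)
      + (E' fun μ => F' fun ν => ent fun v => ∑ s, μ s * ∑ t, ν t * M s t v)
    ≤ (E fun μ => F' fun ν => ent fun v => ∑ s, μ s * ∑ t, ν t * M s t v)
      + E' fun μ => F fun ν => ent fun v => ∑ s, μ s * ∑ t, ν t * M s t v := by
  obtain ⟨A, B, _, _, p, p', κ, hp, hp', hκ, rfl, rfl⟩ := hE
  obtain ⟨C, D, _, _, q, q', ξ, hq, hq', hξ, rfl, rfl⟩ := hF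
  simp only [avg]
  simp only [weighted_sum_comm p' q]
  simp only [← Finset.sum_add_distrib, ← mul_add]
  refine Finset.sum_le_sum fun a _ => mul_le_mul_of_nonneg_left ?_ (hp a)
  refine Finset.sum_le_sum fun c _ => mul_le_mul_of_nonneg_left ?_ (hq c)
  have h := ent_submodular p' q' hp' hq'
    (fun b d v => ∑ s, κ a b s * ∑ t, ξ c d t * M s t v)
    (fun b d v => Finset.sum_nonneg fun s _ => mul_nonneg (hκ a b s) <|
      Finset.sum_nonneg fun t _ => mul_nonneg (hξ c d t) (hM s t v))
  have l1 : ∀ G : S → ℝ, ∑ s, (∑ b, p' b * κ a b s) * G s = ∑ b, p' b * ∑ s, κ a b s * G s := by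
    intro G
    simp only [Finset.sum_mul, Finset.mul_sum, mul_assoc]
    exact Finset.sum_comm
  have l2 : ∀ G : T → ℝ, ∑ t, (∑ d, q' d * ξ c d t) * G t = ∑ d, q' d * ∑ t, ξ c d t * G t := by
    intro G
    simp only [Finset.sum_mul, Finset.mul_sum, mul_assoc]
    exact Finset.sum_comm
  have l3 : ∀ b v, ∑ s, κ a b s * ∑ d, q' d * ∑ t, ξ c d t * M s t v
      = ∑ d, q' d * ∑ s, κ a b s * ∑ t, ξ c d t * M s t v := fun b v =>
    weighted_sum_comm _ _ _
  simp only [l1, l2, l3]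
  linarith

variable {E E' : ((S → ℝ) → ℝ) → ℝ} {F F' : ((T → ℝ) → ℝ) → ℝ} {G G' : ((U → ℝ) → ℝ) → ℝ}
  {W : S → T → U → Y → ℝ}

theorem obsEnt_submodular_left (hW : ∀ s t u v, 0 ≤ W s t u v) (hE : Refines E E')
    (hF : Refines F F') (hG : IsAverage G) :
    obsEnt W E F G + obsEnt W E' F' G ≤ obsEnt W E F' G + obsEnt W E' F G := by
  have sw : ∀ {E : ((S → ℝ) → ℝ) → ℝ} {F : ((T → ℝ) → ℝ) → ℝ}, IsAverage E → IsAverage F →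
      obsEnt W E F G = G fun ρ => E fun μ => F fun ν => ent fun v =>
        ∑ s, μ s * ∑ t, ν t * ∑ u, ρ u * W s t u v := by
    intro E F hE hF
    rw [← hE.comm hG]
    unfold obsEnt
    congr 1
    funext μ
    rw [← hF.comm hG]
    rfl
  rw [sw hE.isAverage_left hF.isAverage_left, sw hE.isAverage_right hF.isAverage_right,
    sw hE.isAverage_left hF.isAverage_right, sw hE.isAverage_right hF.isAverage_left,
    ← hG.map_add, ← hG.map_add]
  exact hG.mono fun ρ hρ => hE.ent_le hF _ fun s t v =>
    Finset.sum_nonneg fun u _ => mul_nonneg (hρ u) (hW s t u v)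

theorem obsEnt_submodular_outer (hW : ∀ s t u v, 0 ≤ W s t u v) (hE : Refines E E')
    (hF : IsAverage F) (hG : Refines G G') :
    obsEnt W E F G + obsEnt W E' F G' ≤ obsEnt W E F G' + obsEnt W E' F G := by
  have sw : ∀ {E : ((S → ℝ) → ℝ) → ℝ} {G : ((U → ℝ) → ℝ) → ℝ}, IsAverage E →
      obsEnt W E F G = F fun ν => E fun μ => G fun ρ => ent fun v =>
        ∑ s, μ s * ∑ u, ρ u * ∑ t, ν t * W s t u v := by
    intro E G hE
    rw [← hE.comm hF]
    have e : ∀ μ ν ρ, outLaw W μ ν ρ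
        = fun v => ∑ s, μ s * ∑ u, ρ u * ∑ t, ν t * W s t u v := fun μ ν ρ =>
      funext fun v => Finset.sum_congr rfl fun s _ => by rw [weighted_sum_comm]
    simp only [obsEnt, e]
  rw [sw hE.isAverage_left, sw hE.isAverage_right, sw hE.isAverage_left, sw hE.isAverage_right,
    ← hF.map_add, ← hF.map_add]
  exact hF.mono fun ν hν => hE.ent_le hG _ fun s u v =>
    Finset.sum_nonneg fun t _ => mul_nonneg (hν t) (hW s t u v)

theorem obsEnt_submodular_right (hW : ∀ s t u v, 0 ≤ W s t u v) (hE : IsAverage E)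
    (hF : Refines F F') (hG : Refines G G') :
    obsEnt W E F G + obsEnt W E F' G' ≤ obsEnt W E F G' + obsEnt W E F' G := by
  unfold obsEnt
  rw [← hE.map_add, ← hE.map_add]
  refine hE.mono fun μ hμ => ?_
  have h := hF.ent_le hG (fun t u v => ∑ s, μ s * W s t u v) fun t u v =>
    Finset.sum_nonneg fun s _ => mul_nonneg (hμ s) (hW s t u v)
  have e : ∀ ν ρ, (fun v => ∑ t, ν t * ∑ u, ρ u * ∑ s, μ s * W s t u v) = outLaw W μ ν ρ := by
    intro ν ρ
    funext v
    simp only [outLaw, weighted_sum_comm (fun u => ρ u) (fun s => μ s)]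
    exact weighted_sum_comm _ _ _
  simpa only [e] using h

variable {A B : Type} [Fintype A] [Fintype B]

theorem pointMass_nonneg (s s' : S) : 0 ≤ pointMass s s' := by
  unfold pointMass
  split_ifs <;> norm_num

theorem refines_unobserved_layerObs {pA : A → ℝ} {pB : B → ℝ} (hA : ∀ a, 0 ≤ pA a)
    (hB : ∀ b, 0 ≤ pB b) {f : A → B → S} {p : S → ℝ}
    (h : ∀ s, ∑ a, pA a * ∑ b, pB b * pointMass (f a b) s = p s) :
    Refines (unobserved p) (layerObs pA pB f) := by
  refine ⟨Unit, A, inferInstance, inferInstance, fun _ => 1, pA, fun _ => layerLaw pB f,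
    fun _ => zero_le_one, hA, fun _ a s => Finset.sum_nonneg fun b _ =>
      mul_nonneg (hB b) (pointMass_nonneg _ _), ?_, ?_⟩
  · funext F
    simp only [avg, unobserved, layerLaw, h]
    simp
  · funext F
    simp [layerObs, avg]

theorem refines_layerObs_observed {pA : A → ℝ} {pB : B → ℝ} (hA : ∀ a, 0 ≤ pA a)
    (hB : ∀ b, 0 ≤ pB b) {f : A → B → S} {p : S → ℝ}
    (h : ∀ s, ∑ a, pA a * ∑ b, pB b * pointMass (f a b) s = p s) :
    Refines (layerObs pA pB f) (observed p) := by
  refine ⟨A, B, inferInstance, inferInstance, pA, pB, fun a b => pointMass (f a b), hA, hB,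
    fun a b s => pointMass_nonneg _ _, rfl, ?_⟩
  funext F
  simp only [observed, ← h, Finset.sum_mul, mul_assoc]
  rw [Finset.sum_comm]
  refine Finset.sum_congr rfl fun a _ => ?_
  rw [← Finset.mul_sum, ← sum_layerLaw_mul pB f a (fun s => F (pointMass s))]
  simp only [layerLaw, Finset.sum_mul, mul_assoc]

theorem refines_unobserved_observed {p : S → ℝ} (hp : ∀ s, 0 ≤ p s) :
    Refines (unobserved p) (observed p) := by
  refine ⟨Unit, S, inferInstance, inferInstance, fun _ => 1, p, fun _ => pointMass,
    fun _ => zero_le_one, hp, fun _ s s' => pointMass_nonneg _ _, ?_, ?_⟩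
  · funext F
    simp only [avg, unobserved, sum_mul_pointMass]
    simp
  · funext F
    simp [observed]

end Refinement

section Polymatroid

/-- Rates of the layer order `S' → T' → S'' → U → T''`, with `K i j k` the conditional entropy of
the output given the first `i`, `j`, `k` layers of `S`, `T`, `U`. -/
def OrderSTSUT (K : Fin 3 → Fin 3 → Fin 2 → ℝ) (rS rT rU : ℝ) : Prop :=
  rS ≤ K 0 0 0 - K 1 0 0 + (K 1 1 0 - K 2 1 0) ∧
  rT ≤ K 1 0 0 - K 1 1 0 + (K 2 1 1 - K 2 2 1) ∧
  rU ≤ K 2 1 0 - K 2 1 1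

/-- Rates of the layer order `T' → U → S' → T'' → S''`. -/
def OrderTUSTS (K : Fin 3 → Fin 3 → Fin 2 → ℝ) (rS rT rU : ℝ) : Prop :=
  rS ≤ K 0 1 1 - K 1 1 1 + (K 1 2 1 - K 2 2 1) ∧
  rT ≤ K 0 0 0 - K 0 1 0 + (K 1 1 1 - K 1 2 1) ∧
  rU ≤ K 0 1 0 - K 0 1 1

/-- Rates of the layer order `T' → S' → U → S'' → T''`. -/
def OrderTSUST (K : Fin 3 → Fin 3 → Fin 2 → ℝ) (rS rT rU : ℝ) : Prop :=
  rS ≤ K 0 1 0 - K 1 1 0 + (K 1 1 1 - K 2 1 1) ∧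
  rT ≤ K 0 0 0 - K 0 1 0 + (K 2 1 1 - K 2 2 1) ∧
  rU ≤ K 1 1 0 - K 1 1 1

/-- The seven inequalities of the three-user MAC region. -/
def MacBounds (k : Fin 2 → Fin 2 → Fin 2 → ℝ) (rS rT rU : ℝ) : Prop :=
  rS ≤ k 0 1 1 - k 1 1 1 ∧ rT ≤ k 1 0 1 - k 1 1 1 ∧ rU ≤ k 1 1 0 - k 1 1 1 ∧
  rS + rT ≤ k 0 0 1 - k 1 1 1 ∧ rS + rU ≤ k 0 1 0 - k 1 1 1 ∧ rT + rU ≤ k 1 0 0 - k 1 1 1 ∧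
  rS + rT + rU ≤ k 0 0 0 - k 1 1 1

/-- Submodularity in each pair of coordinates. -/
def PairSubmodular {a b c : ℕ} (K : Fin a → Fin b → Fin c → ℝ) : Prop :=
  (∀ i i' j j' k, i < i' → j < j' → K i j k + K i' j' k ≤ K i j' k + K i' j k) ∧
  (∀ i i' j k k', i < i' → k < k' → K i j k + K i' j k' ≤ K i j k' + K i' j k) ∧
  (∀ i j l k m, j < l → k < m → K i j k + K i l m ≤ K i j m + K i l k)

/-- The values of `K` with each of the inputs observed either fully or not at all. -/
def corners (K : Fin 3 → Fin 3 → Fin 2 → ℝ) : Fin 2 → Fin 2 → Fin 2 → ℝ :=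
  fun i j k => K (![0, 2] i) (![0, 2] j) k

/-- Multilinear interpolation of the corner values, with weights `a` and `b` in the middle. -/
def interp (k : Fin 2 → Fin 2 → Fin 2 → ℝ) (a b : ℝ) : Fin 3 → Fin 3 → Fin 2 → ℝ :=
  fun i j l => (1 - ![0, a, 1] i) * ((1 - ![0, b, 1] j) * k 0 0 l + ![0, b, 1] j * k 0 1 l)
    + ![0, a, 1] i * ((1 - ![0, b, 1] j) * k 1 0 l + ![0, b, 1] j * k 1 1 l)

theorem macBounds_of_order {K : Fin 3 → Fin 3 → Fin 2 → ℝ} (hK : PairSubmodular K)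
    {rS rT rU : ℝ}
    (h : OrderSTSUT K rS rT rU ∨ OrderTUSTS K rS rT rU ∨ OrderTSUST K rS rT rU) :
    MacBounds (corners K) rS rT rU := by
  obtain ⟨h1, h2, h3⟩ := hK
  have a1 := fun k => h1 0 1 0 1 k (by decide) (by decide)
  have a2 := fun k => h1 0 1 1 2 k (by decide) (by decide)
  have a3 := fun k => h1 1 2 0 1 k (by decide) (by decide)
  have a4 := fun k => h1 1 2 1 2 k (by decide) (by decide)
  have b1 := fun j => h2 0 1 j 0 1 (by decide) (by decide)
  have b2 := fun j => h2 1 2 j 0 1 (by decide) (by decide)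
  have c1 := fun i => h3 i 0 1 0 1 (by decide) (by decide)
  have c2 := fun i => h3 i 1 2 0 1 (by decide) (by decide)
  have a10 := a1 0; have a11 := a1 1; have a20 := a2 0; have a21 := a2 1
  have a30 := a3 0; have a31 := a3 1; have a40 := a4 0; have a41 := a4 1
  have b10 := b1 0; have b11 := b1 1; have b12 := b1 2
  have b20 := b2 0; have b21 := b2 1; have b22 := b2 2
  have c10 := c1 0; have c11 := c1 1; have c12 := c1 2
  have c20 := c2 0; have c21 := c2 1; have c22 := c2 2
  clear a1 a2 a3 a4 b1 b2 c1 c2 h1 h2 h3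
  simp only [MacBounds, corners, Matrix.cons_val_zero, Matrix.cons_val_one]
  rcases h with ⟨hS, hT, hU⟩ | ⟨hS, hT, hU⟩ | ⟨hS, hT, hU⟩ <;>
    refine ⟨?_, ?_, ?_, ?_, ?_, ?_, ?_⟩ <;> linarith

theorem exists_mix {x y r : ℝ} (h1 : x ≤ r) (h2 : r ≤ y) :
    ∃ t, 0 ≤ t ∧ t ≤ 1 ∧ r = (1 - t) * x + t * y := by
  rcases h1.eq_or_lt with h | h
  · exact ⟨0, le_rfl, zero_le_one, by rw [h]; ring⟩
  · have hxy : 0 < y - x := by linarith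
    refine ⟨(r - x) / (y - x), div_nonneg (by linarith) hxy.le,
      (div_le_one hxy).2 (by linarith), ?_⟩
    field_simp
    ring

/-- Every point of the MAC region lies below a point of its dominant face. -/
theorem exists_tight {k : Fin 2 → Fin 2 → Fin 2 → ℝ} (hk : PairSubmodular k) {rS rT rU : ℝ}
    (h : MacBounds k rS rT rU) : ∃ rS' rT' rU', rS ≤ rS' ∧ rT ≤ rT' ∧ rU ≤ rU' ∧
      MacBounds k rS' rT' rU' ∧ rS' + rT' + rU' = k 0 0 0 - k 1 1 1 := by
  obtain ⟨s1, s2, s3⟩ := hk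
  have a0 := s1 0 1 0 1 0 (by decide) (by decide)
  have a1 := s1 0 1 0 1 1 (by decide) (by decide)
  have b0 := s2 0 1 0 0 1 (by decide) (by decide)
  have b1 := s2 0 1 1 0 1 (by decide) (by decide)
  have c0 := s3 0 0 1 0 1 (by decide) (by decide)
  have c1 := s3 1 0 1 0 1 (by decide) (by decide)
  clear s1 s2 s3
  have min4 : ∀ a b c d : ℝ, ∃ m, m ≤ a ∧ m ≤ b ∧ m ≤ c ∧ m ≤ d ∧
      (m = a ∨ m = b ∨ m = c ∨ m = d) := by
    intro a b c d
    refine ⟨min (min a b) (min c d), by simp, by simp, by simp, by simp, ?_⟩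
    rcases min_choice a b with h1 | h1 <;> rcases min_choice c d with h2 | h2 <;>
      rcases min_choice (min a b) (min c d) with h3 | h3 <;> rw [h3] <;> simp [h1, h2]
  unfold MacBounds at *
  generalize k 0 0 0 = k000 at *
  generalize k 0 0 1 = k001 at *
  generalize k 0 1 0 = k010 at *
  generalize k 0 1 1 = k011 at *
  generalize k 1 0 0 = k100 at *
  generalize k 1 0 1 = k101 at *
  generalize k 1 1 0 = k110 at *
  generalize k 1 1 1 = k111 at *
  obtain ⟨h1, h2, h3, h4, h5, h6, h7⟩ := h
  obtain ⟨x, x1, x2, x3, x4, hx⟩ := min4 (k011 - k111) (k001 - k111 - rT) (k010 - k111 - rU)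
    (k000 - k111 - rT - rU)
  have hxS : rS ≤ x := by rcases hx with h | h | h | h <;> linarith
  obtain ⟨y, y1, y2, y3, y4, hy⟩ := min4 (k101 - k111) (k001 - k111 - x) (k100 - k111 - rU)
    (k000 - k111 - x - rU)
  have hyT : rT ≤ y := by rcases hy with h | h | h | h <;> linarith
  obtain ⟨z, z1, z2, z3, z4, hz⟩ := min4 (k110 - k111) (k010 - k111 - x) (k100 - k111 - y)
    (k000 - k111 - x - y)
  have hzU : rU ≤ z := by rcases hz with h | h | h | h <;> linarith
  refine ⟨x, y, z, hxS, hyT, hzU, ⟨x1, y1, z1, by linarith, by linarith, by linarith,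
    by linarith⟩, le_antisymm (by linarith) ?_⟩
  rcases hx with hx | hx | hx | hx <;> rcases hy with hy | hy | hy | hy <;>
    rcases hz with hz | hz | hz | hz <;> linarith

/-- Every point of the MAC region is achieved by one of three layer orders, for suitable split
weights. -/
theorem exists_order_interp {k : Fin 2 → Fin 2 → Fin 2 → ℝ} (hk : PairSubmodular k)
    {rS rT rU : ℝ} (h : MacBounds k rS rT rU) :
    ∃ a b, 0 ≤ a ∧ a ≤ 1 ∧ 0 ≤ b ∧ b ≤ 1 ∧
      (OrderSTSUT (interp k a b) rS rT rU ∨ OrderTUSTS (interp k a b) rS rT rU ∨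
        OrderTSUST (interp k a b) rS rT rU) := by
  obtain ⟨xS, xT, xU, hS, hT, hU, hx, hsum⟩ := exists_tight hk h
  obtain ⟨s1, s2, s3⟩ := hk
  have a0 := s1 0 1 0 1 0 (by decide) (by decide)
  have a1 := s1 0 1 0 1 1 (by decide) (by decide)
  have b0 := s2 0 1 0 0 1 (by decide) (by decide)
  have b1 := s2 0 1 1 0 1 (by decide) (by decide)
  have c0 := s3 0 0 1 0 1 (by decide) (by decide)
  have c1 := s3 1 0 1 0 1 (by decide) (by decide)
  clear s1 s2 s3 h
  obtain ⟨h1, h2, h3, h4, h5, h6, h7⟩ := hx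
  simp only [OrderSTSUT, OrderTUSTS, OrderTSUST, interp, Matrix.cons_val_zero,
    Matrix.cons_val_one, Matrix.cons_val]
  generalize k 0 0 0 = k000 at *
  generalize k 0 0 1 = k001 at *
  generalize k 0 1 0 = k010 at *
  generalize k 0 1 1 = k011 at *
  generalize k 1 0 0 = k100 at *
  generalize k 1 0 1 = k101 at *
  generalize k 1 1 0 = k110 at *
  generalize k 1 1 1 = k111 at *
  obtain ⟨t, t0, t1, et⟩ := exists_mix (x := k000 - k010) (y := k101 - k111) (r := xT)
    (by linarith) h2
  obtain ⟨b, hb0, hb1, rfl⟩ : ∃ b, 0 ≤ b ∧ b ≤ 1 ∧ t = 1 - b :=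
    ⟨1 - t, by linarith, by linarith, by ring⟩
  rcases lt_or_ge ((1 - b) * (k100 - k101) + b * (k110 - k111)) xU with hhi | hhi
  · obtain ⟨b', hb0', hb1', eb⟩ := exists_mix (x := k100 - k101) (y := k110 - k111) (r := xU)
      (by nlinarith [mul_nonneg hb0 (sub_nonneg.2 c1)]) h3
    have hbb : b ≤ b' := by
      by_contra! hlt
      nlinarith [mul_nonneg (sub_nonneg.2 hlt.le) (sub_nonneg.2 c1)]
    obtain ⟨t, ht0, ht1, ea⟩ := exists_mix (x := k000 - k100)
      (y := (1 - b') * (k000 - k100) + b' * (k010 - k110)) (r := xS) (by linarith)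
      (by nlinarith [mul_nonneg (sub_nonneg.2 hbb) (sub_nonneg.2 a0)])
    refine ⟨1 - t, b', by linarith, by linarith, hb0', hb1', Or.inl ⟨hS.trans (le_of_eq ?_),
      hT.trans (le_of_eq ?_), hU.trans (le_of_eq ?_)⟩⟩
    · linear_combination ea
    · linear_combination hsum - ea - eb
    · linear_combination eb
  rcases lt_or_ge xU ((1 - b) * (k000 - k001) + b * (k010 - k011)) with hlo | hlo
  · obtain ⟨b', hb0', hb1', eb⟩ := exists_mix (x := k000 - k001) (y := k010 - k011) (r := xU)
      (by linarith)
      (by nlinarith [mul_nonneg (sub_nonneg.2 hb1) (sub_nonneg.2 c0)])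
    have hbb : b' ≤ b := by
      by_contra! hlt
      nlinarith [mul_nonneg (sub_nonneg.2 hlt.le) (sub_nonneg.2 c0)]
    obtain ⟨t, ht0, ht1, ea⟩ := exists_mix
      (x := (1 - b') * (k001 - k101) + b' * (k011 - k111)) (y := k011 - k111) (r := xS)
      (by nlinarith [mul_nonneg (sub_nonneg.2 hbb) (sub_nonneg.2 a1)]) h1
    refine ⟨1 - t, b', by linarith, by linarith, hb0', hb1', Or.inr (Or.inl
      ⟨hS.trans (le_of_eq ?_), hT.trans (le_of_eq ?_), hU.trans (le_of_eq ?_)⟩)⟩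
    · linear_combination ea
    · linear_combination hsum - ea - eb
    · linear_combination eb
  · obtain ⟨a, ha0, ha1, ea⟩ := exists_mix hlo hhi
    refine ⟨a, b, ha0, ha1, hb0, hb1, Or.inr (Or.inr
      ⟨hS.trans (le_of_eq ?_), hT.trans (le_of_eq ?_), hU.trans (le_of_eq ?_)⟩)⟩
    · linear_combination hsum - ea - et
    · linear_combination et
    · linear_combination ea

end Polymatroid

section Tables

variable {Ω S T U Y Ωσ Ωτ Ωυ : Type} [Fintype Ω] [Fintype S] [Fintype T] [Fintype U] [Fintype Y]
  [Fintype Ωσ] [Fintype Ωτ] [Fintype Ωυ] {a b c : ℕ}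

/-- Conditional output entropies for families of observation levels of the three inputs. -/
def obsTable (W : S → T → U → Y → ℝ) (E : Fin a → ((S → ℝ) → ℝ) → ℝ)
    (F : Fin b → ((T → ℝ) → ℝ) → ℝ) (G : Fin c → ((U → ℝ) → ℝ) → ℝ) :
    Fin a → Fin b → Fin c → ℝ :=
  fun i j k => obsEnt W (E i) (F j) (G k)

/-- `D i j k` is the conditional entropy of `y` given any variable whose level sets are the
classes of the relation `R i j k`. -/
def Tabulates (q : Ω → ℝ) (y : Ω → Y) (R : Fin a → Fin b → Fin c → Ω → Ω → Prop)
    (D : Fin a → Fin b → Fin c → ℝ) : Prop :=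
  ∀ (ζ : Type) [Fintype ζ] (Z : Ω → ζ) (i : Fin a) (j : Fin b) (k : Fin c),
    (∀ ω ω', Z ω = Z ω' ↔ R i j k ω ω') → condEnt q Z y = D i j k

/-- `E` averages over the conditional laws of `fs` given a variable whose level sets are the
classes of `r`. -/
def ObsLevel (pσ : Ωσ → ℝ) (fs : Ωσ → S) (r : Ωσ → Ωσ → Prop) (E : ((S → ℝ) → ℝ) → ℝ) : Prop :=
  ∃ (A : Type) (_ : Fintype A) (α : Ωσ → A) (p : A → ℝ) (κ : A → S → ℝ),
    Realizes pσ fs α p κ ∧ avg p κ = E ∧ ∀ σ σ', α σ = α σ' ↔ r σ σ'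

theorem Tabulates.cmiOf_eq {q : Ω → ℝ} {y : Ω → Y} {R : Fin a → Fin b → Fin c → Ω → Ω → Prop}
    {D : Fin a → Fin b → Fin c → ℝ} (h : Tabulates q y R D) {α γ : Type} [Fintype α] [Fintype γ]
    (A : Ω → α) (C : Ω → γ) (i : Fin a) (j : Fin b) (k : Fin c) (i' : Fin a) (j' : Fin b)
    (k' : Fin c) (hC : ∀ ω ω', C ω = C ω' ↔ R i j k ω ω')
    (hA : ∀ ω ω', A ω = A ω' ∧ C ω = C ω' ↔ R i' j' k' ω ω') :
    cmiOf q A y C = D i j k - D i' j' k' := by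
  rw [cmiOf_eq_condEnt_sub, h _ _ i j k hC, h _ _ i' j' k' fun ω ω' => by
    rw [Prod.mk.injEq, hA]]

theorem Tabulates.miOf_eq {q : Ω → ℝ} {y : Ω → Y} {R : Fin a → Fin b → Fin c → Ω → Ω → Prop}
    {D : Fin a → Fin b → Fin c → ℝ} (h : Tabulates q y R D) (hq : ∑ ω, q ω = 1) {α : Type}
    [Fintype α] (A : Ω → α) (i : Fin a) (j : Fin b) (k : Fin c) (i' : Fin a) (j' : Fin b)
    (k' : Fin c) (h0 : ∀ ω ω', R i j k ω ω') (hA : ∀ ω ω', A ω = A ω' ↔ R i' j' k' ω ω') :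
    miOf q A y = D i j k - D i' j' k' := by
  rw [miOf_eq_condEnt_sub q hq, h _ _ i' j' k' hA, h _ _ i j k fun ω ω' => by simp [h0]]

theorem tabulates_of_model {q : Ω → ℝ} {π : Ω → Ωσ × Ωτ × Ωυ × Y} {pσ : Ωσ → ℝ} {fs : Ωσ → S}
    {pτ : Ωτ → ℝ} {ft : Ωτ → T} {pυ : Ωυ → ℝ} {fu : Ωυ → U} {W : S → T → U → Y → ℝ}
    (hW : ∀ s t u, ∑ v, W s t u v = 1) (hq : pushf q π = model pσ fs pτ ft pυ fu W)
    {rS : Fin a → Ωσ → Ωσ → Prop} {rT : Fin b → Ωτ → Ωτ → Prop} {rU : Fin c → Ωυ → Ωυ → Prop}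
    {E : Fin a → ((S → ℝ) → ℝ) → ℝ} {F : Fin b → ((T → ℝ) → ℝ) → ℝ}
    {G : Fin c → ((U → ℝ) → ℝ) → ℝ} (hE : ∀ i, ObsLevel pσ fs (rS i) (E i))
    (hF : ∀ j, ObsLevel pτ ft (rT j) (F j)) (hG : ∀ k, ObsLevel pυ fu (rU k) (G k)) :
    Tabulates q (fun ω => (π ω).2.2.2)
      (fun i j k ω ω' => rS i (π ω).1 (π ω').1 ∧ rT j (π ω).2.1 (π ω').2.1 ∧
        rU k (π ω).2.2.1 (π ω').2.2.1) (obsTable W E F G) := by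
  intro ζ _ Z i j k hZ
  obtain ⟨A, _, α, pA, κA, hα, hEi, hrS⟩ := hE i
  obtain ⟨B, _, β, pB, κB, hβ, hFj, hrT⟩ := hF j
  obtain ⟨C, _, γ, pC, κC, hγ, hGk, hrU⟩ := hG k
  rw [obsTable, ← hEi, ← hFj, ← hGk]
  exact condEnt_eq_obsEnt hW hq hα hβ hγ Z fun ω ω' => by rw [hZ, hrS, hrT, hrU]

theorem sum_model {pσ : Ωσ → ℝ} {fs : Ωσ → S} {pτ : Ωτ → ℝ} {ft : Ωτ → T} {pυ : Ωυ → ℝ}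
    {fu : Ωυ → U} {W : S → T → U → Y → ℝ} (hW : ∀ s t u, ∑ v, W s t u v = 1)
    (hσ : ∑ σ, pσ σ = 1) (hτ : ∑ τ, pτ τ = 1) (hυ : ∑ υ, pυ υ = 1) :
    ∑ x, model pσ fs pτ ft pυ fu W x = 1 := by
  simp only [model, Fintype.sum_prod_type, ← Finset.mul_sum, hW, mul_one, hυ, hτ, hσ]

theorem obsLevel_none {pσ : Ωσ → ℝ} {fs : Ωσ → S} {p : S → ℝ} (hp : ∑ s, p s = 1)
    (h : pushf pσ fs = p) : ObsLevel pσ fs (fun _ _ => True) (unobserved p) :=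
  ⟨Unit, inferInstance, _, _, _, realizes_unit hp h, avg_unit p, fun _ _ => by simp⟩

theorem obsLevel_full {pσ : Ωσ → ℝ} {fs : Ωσ → S} {p : S → ℝ} (h : pushf pσ fs = p) :
    ObsLevel pσ fs Eq (observed p) :=
  ⟨Ωσ, inferInstance, _, _, _, realizes_full pσ fs, avg_full h, fun _ _ => Iff.rfl⟩

/-- Equality of the first `i`, `j`, `k` layers of the three inputs. -/
def splitRel {S₁ S₂ S₃ T₁ T₂ : Type} (s₁ : Ω → S₁) (s₂ : Ω → S₂) (s₃ : Ω → S₃) (t₁ : Ω → T₁)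
    (t₂ : Ω → T₂) (u : Ω → U) (i : Fin 4) (j : Fin 3) (k : Fin 2) (ω ω₂ : Ω) : Prop :=
  (![True, s₁ ω = s₁ ω₂, s₁ ω = s₁ ω₂ ∧ s₂ ω = s₂ ω₂,
      s₁ ω = s₁ ω₂ ∧ s₂ ω = s₂ ω₂ ∧ s₃ ω = s₃ ω₂] i) ∧
    (![True, t₁ ω = t₁ ω₂, t₁ ω = t₁ ω₂ ∧ t₂ ω = t₂ ω₂] j) ∧ (![True, u ω = u ω₂] k)

/-- Equality of those of the three inputs which are selected by `i`, `j`, `k`. -/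
def inputRel (s : Ω → S) (t : Ω → T) (u : Ω → U) (i j k : Fin 2) (ω ω' : Ω) : Prop :=
  (![True, s ω = s ω'] i) ∧ (![True, t ω = t ω'] j) ∧ (![True, u ω = u ω'] k)

section Orders

variable {S₁ S₂ S₃ T₁ T₂ : Type} [Fintype S₁] [Fintype S₂] [Fintype S₃] [Fintype T₁] [Fintype T₂]
  {q : Ω → ℝ} {s₁ : Ω → S₁} {s₂ : Ω → S₂} {s₃ : Ω → S₃} {t₁ : Ω → T₁} {t₂ : Ω → T₂} {u : Ω → U}
  {y : Ω → Y} {D : Fin 4 → Fin 3 → Fin 2 → ℝ}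

theorem rates_STSSUT (hq : ∑ ω, q ω = 1) (h : Tabulates q y (splitRel s₁ s₂ s₃ t₁ t₂ u) D)
    {rS rT rU : ℝ} :
    (rS ≤ miOf q (fun ω => s₁ ω) (fun ω => y ω)
        + cmiOf q (fun ω => s₂ ω) (fun ω => y ω) (fun ω => (s₁ ω, t₁ ω))
        + cmiOf q (fun ω => s₃ ω) (fun ω => y ω) (fun ω => (s₁ ω, t₁ ω, s₂ ω)) ∧
      rT ≤ cmiOf q (fun ω => t₁ ω) (fun ω => y ω) (fun ω => s₁ ω)
        + cmiOf q (fun ω => t₂ ω) (fun ω => y ω) (fun ω => (s₁ ω, t₁ ω, s₂ ω, s₃ ω, u ω)) ∧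
      rU ≤ cmiOf q (fun ω => u ω) (fun ω => y ω) (fun ω => (s₁ ω, t₁ ω, s₂ ω, s₃ ω))) ↔
    OrderSTSUT (fun i j k => D (![0, 1, 3] i) j k) rS rT rU := by
  rw [h.miOf_eq hq _ 0 0 0 1 0 0 (by simp [splitRel]) (by simp [splitRel]),
    h.cmiOf_eq (fun ω => s₂ ω) _ 1 1 0 2 1 0 (by simp [splitRel])
      (by simp [splitRel]; tauto),
    h.cmiOf_eq (fun ω => s₃ ω) _ 2 1 0 3 1 0 (by simp [splitRel]; tauto)
      (by simp [splitRel]; tauto),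
    h.cmiOf_eq (fun ω => t₁ ω) _ 1 0 0 1 1 0 (by simp [splitRel])
      (by simp [splitRel]; tauto),
    h.cmiOf_eq (fun ω => t₂ ω) _ 3 1 1 3 2 1 (by simp [splitRel]; tauto)
      (by simp [splitRel]; tauto),
    h.cmiOf_eq (fun ω => u ω) _ 3 1 0 3 1 1 (by simp [splitRel]; tauto)
      (by simp [splitRel]; tauto)]
  simp only [OrderSTSUT, Matrix.cons_val]
  refine and_congr ?_ (and_congr ?_ ?_) <;> constructor <;> intro h <;> linarith

theorem rates_TUSTSS (hq : ∑ ω, q ω = 1) (h : Tabulates q y (splitRel s₁ s₂ s₃ t₁ t₂ u) D)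
    {rS rT rU : ℝ} :
    (rS ≤ cmiOf q (fun ω => s₁ ω) (fun ω => y ω) (fun ω => (t₁ ω, u ω))
        + cmiOf q (fun ω => s₂ ω) (fun ω => y ω) (fun ω => (t₁ ω, u ω, s₁ ω, t₂ ω))
        + cmiOf q (fun ω => s₃ ω) (fun ω => y ω) (fun ω => (t₁ ω, u ω, s₁ ω, t₂ ω, s₂ ω)) ∧
      rT ≤ miOf q (fun ω => t₁ ω) (fun ω => y ω)
        + cmiOf q (fun ω => t₂ ω) (fun ω => y ω) (fun ω => (t₁ ω, u ω, s₁ ω)) ∧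
      rU ≤ cmiOf q (fun ω => u ω) (fun ω => y ω) (fun ω => t₁ ω)) ↔
    OrderTUSTS (fun i j k => D (![0, 1, 3] i) j k) rS rT rU := by
  rw [h.cmiOf_eq (fun ω => s₁ ω) _ 0 1 1 1 1 1 (by simp [splitRel])
      (by simp [splitRel]),
    h.cmiOf_eq (fun ω => s₂ ω) _ 1 2 1 2 2 1 (by simp [splitRel]; tauto)
      (by simp [splitRel]; tauto),
    h.cmiOf_eq (fun ω => s₃ ω) _ 2 2 1 3 2 1 (by simp [splitRel]; tauto)
      (by simp [splitRel]; tauto),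
    h.miOf_eq hq _ 0 0 0 0 1 0 (by simp [splitRel]) (by simp [splitRel]),
    h.cmiOf_eq (fun ω => t₂ ω) _ 1 1 1 1 2 1 (by simp [splitRel]; tauto)
      (by simp [splitRel]; tauto),
    h.cmiOf_eq (fun ω => u ω) _ 0 1 0 0 1 1 (by simp [splitRel])
      (by simp [splitRel]; tauto)]
  simp only [OrderTUSTS, Matrix.cons_val]
  refine and_congr ?_ (and_congr ?_ ?_) <;> constructor <;> intro h <;> linarith

theorem rates_TSUSST (hq : ∑ ω, q ω = 1) (h : Tabulates q y (splitRel s₁ s₂ s₃ t₁ t₂ u) D)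
    {rS rT rU : ℝ} :
    (rS ≤ cmiOf q (fun ω => s₁ ω) (fun ω => y ω) (fun ω => t₁ ω)
        + cmiOf q (fun ω => s₂ ω) (fun ω => y ω) (fun ω => (t₁ ω, s₁ ω, u ω))
        + cmiOf q (fun ω => s₃ ω) (fun ω => y ω) (fun ω => (t₁ ω, s₁ ω, u ω, s₂ ω)) ∧
      rT ≤ miOf q (fun ω => t₁ ω) (fun ω => y ω)
        + cmiOf q (fun ω => t₂ ω) (fun ω => y ω) (fun ω => (t₁ ω, s₁ ω, u ω, s₂ ω, s₃ ω)) ∧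
      rU ≤ cmiOf q (fun ω => u ω) (fun ω => y ω) (fun ω => (t₁ ω, s₁ ω))) ↔
    OrderTSUST (fun i j k => D (![0, 1, 3] i) j k) rS rT rU := by
  rw [h.cmiOf_eq (fun ω => s₁ ω) _ 0 1 0 1 1 0 (by simp [splitRel])
      (by simp [splitRel]),
    h.cmiOf_eq (fun ω => s₂ ω) _ 1 1 1 2 1 1 (by simp [splitRel]; tauto)
      (by simp [splitRel]; tauto),
    h.cmiOf_eq (fun ω => s₃ ω) _ 2 1 1 3 1 1 (by simp [splitRel]; tauto)
      (by simp [splitRel]; tauto),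
    h.miOf_eq hq _ 0 0 0 0 1 0 (by simp [splitRel]) (by simp [splitRel]),
    h.cmiOf_eq (fun ω => t₂ ω) _ 3 1 1 3 2 1 (by simp [splitRel]; tauto)
      (by simp [splitRel]; tauto),
    h.cmiOf_eq (fun ω => u ω) _ 1 1 0 1 1 1 (by simp [splitRel]; tauto)
      (by simp [splitRel]; tauto)]
  simp only [OrderTSUST, Matrix.cons_val]
  refine and_congr ?_ (and_congr ?_ ?_) <;> constructor <;> intro h <;> linarith

theorem rates_SSTSUT (hq : ∑ ω, q ω = 1) (h : Tabulates q y (splitRel s₁ s₂ s₃ t₁ t₂ u) D)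
    {rS rT rU : ℝ} :
    (rS ≤ miOf q (fun ω => s₁ ω) (fun ω => y ω)
        + cmiOf q (fun ω => s₂ ω) (fun ω => y ω) (fun ω => s₁ ω)
        + cmiOf q (fun ω => s₃ ω) (fun ω => y ω) (fun ω => (s₁ ω, s₂ ω, t₁ ω)) ∧
      rT ≤ cmiOf q (fun ω => t₁ ω) (fun ω => y ω) (fun ω => (s₁ ω, s₂ ω))
        + cmiOf q (fun ω => t₂ ω) (fun ω => y ω) (fun ω => (s₁ ω, s₂ ω, t₁ ω, s₃ ω, u ω)) ∧
      rU ≤ cmiOf q (fun ω => u ω) (fun ω => y ω) (fun ω => (s₁ ω, s₂ ω, t₁ ω, s₃ ω))) ↔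
    OrderSTSUT (fun i j k => D (![0, 2, 3] i) j k) rS rT rU := by
  rw [h.miOf_eq hq _ 0 0 0 1 0 0 (by simp [splitRel]) (by simp [splitRel]),
    h.cmiOf_eq (fun ω => s₂ ω) _ 1 0 0 2 0 0 (by simp [splitRel])
      (by simp [splitRel]; tauto),
    h.cmiOf_eq (fun ω => s₃ ω) _ 2 1 0 3 1 0 (by simp [splitRel]; tauto)
      (by simp [splitRel]; tauto),
    h.cmiOf_eq (fun ω => t₁ ω) _ 2 0 0 2 1 0 (by simp [splitRel])
      (by simp [splitRel]; tauto),
    h.cmiOf_eq (fun ω => t₂ ω) _ 3 1 1 3 2 1 (by simp [splitRel]; tauto)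
      (by simp [splitRel]; tauto),
    h.cmiOf_eq (fun ω => u ω) _ 3 1 0 3 1 1 (by simp [splitRel]; tauto)
      (by simp [splitRel]; tauto)]
  simp only [OrderSTSUT, Matrix.cons_val]
  refine and_congr ?_ (and_congr ?_ ?_) <;> constructor <;> intro h <;> linarith

theorem rates_TUSSTS (hq : ∑ ω, q ω = 1) (h : Tabulates q y (splitRel s₁ s₂ s₃ t₁ t₂ u) D)
    {rS rT rU : ℝ} :
    (rS ≤ cmiOf q (fun ω => s₁ ω) (fun ω => y ω) (fun ω => (t₁ ω, u ω))
        + cmiOf q (fun ω => s₂ ω) (fun ω => y ω) (fun ω => (t₁ ω, u ω, s₁ ω))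
        + cmiOf q (fun ω => s₃ ω) (fun ω => y ω) (fun ω => (t₁ ω, u ω, s₁ ω, s₂ ω, t₂ ω)) ∧
      rT ≤ miOf q (fun ω => t₁ ω) (fun ω => y ω)
        + cmiOf q (fun ω => t₂ ω) (fun ω => y ω) (fun ω => (t₁ ω, u ω, s₁ ω, s₂ ω)) ∧
      rU ≤ cmiOf q (fun ω => u ω) (fun ω => y ω) (fun ω => t₁ ω)) ↔
    OrderTUSTS (fun i j k => D (![0, 2, 3] i) j k) rS rT rU := by
  rw [h.cmiOf_eq (fun ω => s₁ ω) _ 0 1 1 1 1 1 (by simp [splitRel])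
      (by simp [splitRel]),
    h.cmiOf_eq (fun ω => s₂ ω) _ 1 1 1 2 1 1 (by simp [splitRel]; tauto)
      (by simp [splitRel]; tauto),
    h.cmiOf_eq (fun ω => s₃ ω) _ 2 2 1 3 2 1 (by simp [splitRel]; tauto)
      (by simp [splitRel]; tauto),
    h.miOf_eq hq _ 0 0 0 0 1 0 (by simp [splitRel]) (by simp [splitRel]),
    h.cmiOf_eq (fun ω => t₂ ω) _ 2 1 1 2 2 1 (by simp [splitRel]; tauto)
      (by simp [splitRel]; tauto),
    h.cmiOf_eq (fun ω => u ω) _ 0 1 0 0 1 1 (by simp [splitRel])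
      (by simp [splitRel]; tauto)]
  simp only [OrderTUSTS, Matrix.cons_val]
  refine and_congr ?_ (and_congr ?_ ?_) <;> constructor <;> intro h <;> linarith

theorem rates_TSSUST (hq : ∑ ω, q ω = 1) (h : Tabulates q y (splitRel s₁ s₂ s₃ t₁ t₂ u) D)
    {rS rT rU : ℝ} :
    (rS ≤ cmiOf q (fun ω => s₁ ω) (fun ω => y ω) (fun ω => t₁ ω)
        + cmiOf q (fun ω => s₂ ω) (fun ω => y ω) (fun ω => (t₁ ω, s₁ ω))
        + cmiOf q (fun ω => s₃ ω) (fun ω => y ω) (fun ω => (t₁ ω, s₁ ω, s₂ ω, u ω)) ∧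
      rT ≤ miOf q (fun ω => t₁ ω) (fun ω => y ω)
        + cmiOf q (fun ω => t₂ ω) (fun ω => y ω) (fun ω => (t₁ ω, s₁ ω, s₂ ω, u ω, s₃ ω)) ∧
      rU ≤ cmiOf q (fun ω => u ω) (fun ω => y ω) (fun ω => (t₁ ω, s₁ ω, s₂ ω))) ↔
    OrderTSUST (fun i j k => D (![0, 2, 3] i) j k) rS rT rU := by
  rw [h.cmiOf_eq (fun ω => s₁ ω) _ 0 1 0 1 1 0 (by simp [splitRel])
      (by simp [splitRel]),
    h.cmiOf_eq (fun ω => s₂ ω) _ 1 1 0 2 1 0 (by simp [splitRel]; tauto)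
      (by simp [splitRel]; tauto),
    h.cmiOf_eq (fun ω => s₃ ω) _ 2 1 1 3 1 1 (by simp [splitRel]; tauto)
      (by simp [splitRel]; tauto),
    h.miOf_eq hq _ 0 0 0 0 1 0 (by simp [splitRel]) (by simp [splitRel]),
    h.cmiOf_eq (fun ω => t₂ ω) _ 3 1 1 3 2 1 (by simp [splitRel]; tauto)
      (by simp [splitRel]; tauto),
    h.cmiOf_eq (fun ω => u ω) _ 2 1 0 2 1 1 (by simp [splitRel]; tauto)
      (by simp [splitRel]; tauto)]
  simp only [OrderTSUST, Matrix.cons_val]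
  refine and_congr ?_ (and_congr ?_ ?_) <;> constructor <;> intro h <;> linarith

end Orders

section Mac

variable {q : Ω → ℝ} {s : Ω → S} {t : Ω → T} {u : Ω → U} {y : Ω → Y}
  {D : Fin 2 → Fin 2 → Fin 2 → ℝ}

theorem rates_mac (hq : ∑ ω, q ω = 1) (h : Tabulates q y (inputRel s t u) D) {rS rT rU : ℝ} :
    (rS ≤ cmiOf q (fun ω => s ω) (fun ω => y ω) (fun ω => (t ω, u ω)) ∧
      rT ≤ cmiOf q (fun ω => t ω) (fun ω => y ω) (fun ω => (s ω, u ω)) ∧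
      rU ≤ cmiOf q (fun ω => u ω) (fun ω => y ω) (fun ω => (s ω, t ω)) ∧
      rS + rT ≤ cmiOf q (fun ω => (s ω, t ω)) (fun ω => y ω) (fun ω => u ω) ∧
      rS + rU ≤ cmiOf q (fun ω => (s ω, u ω)) (fun ω => y ω) (fun ω => t ω) ∧
      rT + rU ≤ cmiOf q (fun ω => (t ω, u ω)) (fun ω => y ω) (fun ω => s ω) ∧
      rS + rT + rU ≤ miOf q (fun ω => (s ω, t ω, u ω)) (fun ω => y ω)) ↔
    MacBounds D rS rT rU := by
  rw [h.cmiOf_eq (fun ω => s ω) _ 0 1 1 1 1 1 (by simp [inputRel]) (by simp [inputRel]),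
    h.cmiOf_eq (fun ω => t ω) _ 1 0 1 1 1 1 (by simp [inputRel]) (by simp [inputRel]; tauto),
    h.cmiOf_eq (fun ω => u ω) _ 1 1 0 1 1 1 (by simp [inputRel]) (by simp [inputRel]; tauto),
    h.cmiOf_eq (fun ω => (s ω, t ω)) _ 0 0 1 1 1 1 (by simp [inputRel])
      (by simp [inputRel]; tauto),
    h.cmiOf_eq (fun ω => (s ω, u ω)) _ 0 1 0 1 1 1 (by simp [inputRel])
      (by simp [inputRel]; tauto),
    h.cmiOf_eq (fun ω => (t ω, u ω)) _ 1 0 0 1 1 1 (by simp [inputRel])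
      (by simp [inputRel]; tauto),
    h.miOf_eq hq _ 0 0 0 1 1 1 (by simp [inputRel]) (by simp [inputRel])]
  rfl

theorem rates_mac_swap (hq : ∑ ω, q ω = 1) (h : Tabulates q y (inputRel s t u) D)
    {rS rT rU : ℝ} :
    (rS ≤ cmiOf q (fun ω => s ω) (fun ω => y ω) (fun ω => (u ω, t ω)) ∧
      rU ≤ cmiOf q (fun ω => u ω) (fun ω => y ω) (fun ω => (s ω, t ω)) ∧
      rT ≤ cmiOf q (fun ω => t ω) (fun ω => y ω) (fun ω => (s ω, u ω)) ∧
      rS + rU ≤ cmiOf q (fun ω => (s ω, u ω)) (fun ω => y ω) (fun ω => t ω) ∧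
      rS + rT ≤ cmiOf q (fun ω => (s ω, t ω)) (fun ω => y ω) (fun ω => u ω) ∧
      rU + rT ≤ cmiOf q (fun ω => (u ω, t ω)) (fun ω => y ω) (fun ω => s ω) ∧
      rS + rU + rT ≤ miOf q (fun ω => (s ω, u ω, t ω)) (fun ω => y ω)) ↔
    MacBounds D rS rT rU := by
  have h' : Tabulates q y (inputRel s u t) fun i j k => D i k j := fun ζ _ Z i j k hZ =>
    h ζ Z i k j fun ω ω' => by rw [hZ]; simp only [inputRel]; tauto
  rw [rates_mac hq h']
  simp only [MacBounds]
  constructor <;> rintro ⟨h1, h2, h3, h4, h5, h6, h7⟩ <;>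
    refine ⟨h1, h3, h2, h5, h4, ?_, ?_⟩ <;> linarith

end Mac

end Tables

section Receivers

variable {Ω S T U Y Ωσ Ωτ Ωυ : Type} [Fintype Ω] [Fintype S] [Fintype T] [Fintype U] [Fintype Y]
  [Fintype Ωσ] [Fintype Ωτ] [Fintype Ωυ] {a b c : ℕ}

theorem Tabulates.congr {q : Ω → ℝ} {y : Ω → Y} {R R' : Fin a → Fin b → Fin c → Ω → Ω → Prop}
    {D : Fin a → Fin b → Fin c → ℝ} (h : Tabulates q y R D)
    (hR : ∀ i j k ω ω₂, R' i j k ω ω₂ ↔ R i j k ω ω₂) : Tabulates q y R' D :=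
  fun ζ _ Z i j k hZ => h ζ Z i j k fun ω ω₂ => (hZ ω ω₂).trans (hR i j k ω ω₂)

/-- No observation and full observation of an input of law `p`. -/
def inputLevels (p : S → ℝ) : Fin 2 → ((S → ℝ) → ℝ) → ℝ := ![unobserved p, observed p]

/-- Observation of the first `j` of the two layers of an input of law `p`. -/
def twoLevels {A B : Type} [Fintype A] [Fintype B] (p : S → ℝ) (pA : A → ℝ) (pB : B → ℝ)
    (f : A → B → S) : Fin 3 → ((S → ℝ) → ℝ) → ℝ :=
  ![unobserved p, layerObs pA pB f, observed p]

/-- Observation of the first `i` of the three layers of an input of law `p`. -/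
def threeLevels {A B C : Type} [Fintype A] [Fintype B] [Fintype C] (p : S → ℝ) (pA : A → ℝ)
    (pB : B → ℝ) (pC : C → ℝ) (f : A → B → C → S) : Fin 4 → ((S → ℝ) → ℝ) → ℝ :=
  ![unobserved p, layerObs pA (fun x : B × C => pB x.1 * pC x.2) (fun a x => f a x.1 x.2),
    layerObs (fun x : A × B => pA x.1 * pB x.2) pC (fun x c => f x.1 x.2 c), observed p]

theorem sum_prod_mul {A B : Type} [Fintype A] [Fintype B] {pA : A → ℝ} {pB : B → ℝ}
    (hA : ∑ a, pA a = 1) (hB : ∑ b, pB b = 1) : ∑ x : A × B, pA x.1 * pB x.2 = 1 := by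
  rw [Fintype.sum_prod_type]
  simp [← Finset.mul_sum, hA, hB]

theorem obsLevel_inputLevels {p : S → ℝ} (hp : ∑ s, p s = 1) (k : Fin 2) :
    ObsLevel p id ((![fun _ _ => True, Eq] : Fin 2 → S → S → Prop) k) (inputLevels p k) := by
  have h : pushf p id = p := by
    funext s
    simp [pushf]
  fin_cases k
  · exact obsLevel_none hp h
  · exact obsLevel_full h

theorem obsLevel_twoLevels {A B : Type} [Fintype A] [Fintype B] {p : S → ℝ} {pA : A → ℝ}
    {pB : B → ℝ} {f : A → B → S} (hp : ∑ s, p s = 1) (hB : ∑ b, pB b = 1)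
    (h : pushf (fun x : A × B => pA x.1 * pB x.2) (fun x => f x.1 x.2) = p) (j : Fin 3) :
    ObsLevel (fun x : A × B => pA x.1 * pB x.2) (fun x => f x.1 x.2)
      ((![fun _ _ => True, fun x x' => x.1 = x'.1, Eq] : Fin 3 → A × B → A × B → Prop) j)
      (twoLevels p pA pB f j) := by
  fin_cases j
  · exact obsLevel_none hp h
  · exact ⟨A, inferInstance, Prod.fst, _, _, realizes_layer pA hB f (Equiv.refl _)
      (fun _ _ => rfl) (fun _ _ => rfl) (fun _ _ => rfl), rfl, fun _ _ => Iff.rfl⟩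
  · exact obsLevel_full h

theorem obsLevel_threeLevels {A B C : Type} [Fintype A] [Fintype B] [Fintype C] {p : S → ℝ}
    {pA : A → ℝ} {pB : B → ℝ} {pC : C → ℝ} {f : A → B → C → S} (hp : ∑ s, p s = 1)
    (hB : ∑ b, pB b = 1) (hC : ∑ c, pC c = 1)
    (h : pushf (fun x : A × B × C => pA x.1 * pB x.2.1 * pC x.2.2)
      (fun x => f x.1 x.2.1 x.2.2) = p) (i : Fin 4) :
    ObsLevel (fun x : A × B × C => pA x.1 * pB x.2.1 * pC x.2.2) (fun x => f x.1 x.2.1 x.2.2)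
      ((![fun _ _ => True, fun x x' => x.1 = x'.1, fun x x' => x.1 = x'.1 ∧ x.2.1 = x'.2.1, Eq] :
        Fin 4 → A × B × C → A × B × C → Prop) i) (threeLevels p pA pB pC f i) := by
  fin_cases i
  · exact obsLevel_none hp h
  · exact ⟨A, inferInstance, Prod.fst, _, _, realizes_layer pA (sum_prod_mul hB hC)
      (fun a x => f a x.1 x.2) (Equiv.refl _) (fun _ _ => mul_assoc _ _ _) (fun _ _ => rfl)
      (fun _ _ => rfl), rfl, fun _ _ => Iff.rfl⟩
  · exact ⟨A × B, inferInstance, fun x => (x.1, x.2.1), _, _,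
      realizes_layer (fun x : A × B => pA x.1 * pB x.2) hC (fun x c => f x.1 x.2 c)
        (Equiv.prodAssoc A B C) (fun _ _ => rfl) (fun _ _ => rfl) (fun _ _ => rfl), rfl,
      fun _ _ => Prod.mk_inj⟩
  · exact obsLevel_full h

theorem tabulates_input {q : Ω → ℝ} {s : Ω → S} {t : Ω → T} {u : Ω → U} {y : Ω → Y} {pS : S → ℝ}
    {pT : T → ℝ} {pU : U → ℝ} {W : S → T → U → Y → ℝ} (hW : ∀ s t u, ∑ v, W s t u v = 1)
    (hS : ∑ s, pS s = 1) (hT : ∑ t, pT t = 1) (hU : ∑ u, pU u = 1)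
    (hq : pushf q (fun ω => (s ω, t ω, u ω, y ω)) = model pS id pT id pU id W) :
    Tabulates q y (inputRel s t u)
      (obsTable W (inputLevels pS) (inputLevels pT) (inputLevels pU)) := by
  refine (tabulates_of_model hW hq (obsLevel_inputLevels hS) (obsLevel_inputLevels hT)
    (obsLevel_inputLevels hU)).congr fun i j k ω ω' => ?_
  fin_cases i <;> fin_cases j <;> fin_cases k <;> rfl

theorem tabulates_split {A B C A' B' : Type} [Fintype A] [Fintype B] [Fintype C] [Fintype A']
    [Fintype B'] {q : Ω → ℝ} {s₁ : Ω → A} {s₂ : Ω → B} {s₃ : Ω → C} {t₁ : Ω → A'} {t₂ : Ω → B'}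
    {u : Ω → U} {y : Ω → Y} {pS : S → ℝ} {pT : T → ℝ} {pU : U → ℝ} {W : S → T → U → Y → ℝ}
    {pA : A → ℝ} {pB : B → ℝ} {pC : C → ℝ} {f : A → B → C → S} {pA' : A' → ℝ} {pB' : B' → ℝ}
    {f' : A' → B' → T} (hW : ∀ s t u, ∑ v, W s t u v = 1)
    (hS : ∑ s, pS s = 1) (hT : ∑ t, pT t = 1) (hU : ∑ u, pU u = 1)
    (hB : ∑ b, pB b = 1) (hC : ∑ c, pC c = 1) (hB' : ∑ b, pB' b = 1)
    (hf : pushf (fun x : A × B × C => pA x.1 * pB x.2.1 * pC x.2.2)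
      (fun x => f x.1 x.2.1 x.2.2) = pS)
    (hf' : pushf (fun x : A' × B' => pA' x.1 * pB' x.2) (fun x => f' x.1 x.2) = pT)
    (hq : pushf q (fun ω => ((s₁ ω, s₂ ω, s₃ ω), (t₁ ω, t₂ ω), u ω, y ω))
      = model (fun x : A × B × C => pA x.1 * pB x.2.1 * pC x.2.2) (fun x => f x.1 x.2.1 x.2.2)
          (fun x : A' × B' => pA' x.1 * pB' x.2) (fun x => f' x.1 x.2) pU id W) :
    Tabulates q y (splitRel s₁ s₂ s₃ t₁ t₂ u)
      (obsTable W (threeLevels pS pA pB pC f) (twoLevels pT pA' pB' f') (inputLevels pU)) := by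
  refine (tabulates_of_model hW hq (obsLevel_threeLevels hS hB hC hf)
    (obsLevel_twoLevels hT hB' hf') (obsLevel_inputLevels hU)).congr fun i j k ω ω' => ?_
  refine and_congr ?_ (and_congr ?_ ?_)
  · fin_cases i <;> simp
  · fin_cases j <;> simp
  · fin_cases k <;> rfl

/-- The channel seen by receiver 1, with the private input of user 2 averaged out. -/
def rxChan₁ (pV : 𝒱 → ℝ) (fx : 𝒮 → 𝒯 → 𝒳) (fw : 𝒰 → 𝒱 → 𝒲) (ch : 𝒳 → 𝒲 → 𝒴₁ → 𝒴₂ → ℝ) :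
    𝒮 → 𝒯 → 𝒰 → 𝒴₁ → ℝ :=
  fun s t u y₁ => ∑ v, pV v * ∑ y₂, ch (fx s t) (fw u v) y₁ y₂

/-- The channel seen by receiver 2, with the private input of user 1 averaged out. -/
def rxChan₂ (pT : 𝒯 → ℝ) (fx : 𝒮 → 𝒯 → 𝒳) (fw : 𝒰 → 𝒱 → 𝒲) (ch : 𝒳 → 𝒲 → 𝒴₁ → 𝒴₂ → ℝ) :
    𝒮 → 𝒱 → 𝒰 → 𝒴₂ → ℝ :=
  fun s v u y₂ => ∑ t, pT t * ∑ y₁, ch (fx s t) (fw u v) y₁ y₂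

variable {pS : 𝒮 → ℝ} {pT : 𝒯 → ℝ} {pU : 𝒰 → ℝ} {pV : 𝒱 → ℝ}
  {fx : 𝒮 → 𝒯 → 𝒳} {fw : 𝒰 → 𝒱 → 𝒲} {ch : 𝒳 → 𝒲 → 𝒴₁ → 𝒴₂ → ℝ}

theorem rxChan₁_nonneg (hpV : IsPMF pV) (hch0 : ∀ x w y₁ y₂, 0 ≤ ch x w y₁ y₂) (s : 𝒮) (t : 𝒯)
    (u : 𝒰) (y : 𝒴₁) : 0 ≤ rxChan₁ pV fx fw ch s t u y :=
  Finset.sum_nonneg fun v _ => mul_nonneg (hpV.1 v) (Finset.sum_nonneg fun _ _ => hch0 _ _ _ _)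

theorem rxChan₂_nonneg (hpT : IsPMF pT) (hch0 : ∀ x w y₁ y₂, 0 ≤ ch x w y₁ y₂) (s : 𝒮) (v : 𝒱)
    (u : 𝒰) (y : 𝒴₂) : 0 ≤ rxChan₂ pT fx fw ch s v u y :=
  Finset.sum_nonneg fun t _ => mul_nonneg (hpT.1 t) (Finset.sum_nonneg fun _ _ => hch0 _ _ _ _)

theorem sum_rxChan₁ (hpV : IsPMF pV) (hch1 : ∀ x w, ∑ y₁, ∑ y₂, ch x w y₁ y₂ = 1) (s : 𝒮) (t : 𝒯)
    (u : 𝒰) : ∑ y, rxChan₁ pV fx fw ch s t u y = 1 := by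
  simp only [rxChan₁]
  rw [Finset.sum_comm]
  simp only [← Finset.mul_sum, hch1, mul_one, hpV.2]

theorem sum_rxChan₂ (hpT : IsPMF pT) (hch1 : ∀ x w, ∑ y₁, ∑ y₂, ch x w y₁ y₂ = 1) (s : 𝒮) (v : 𝒱)
    (u : 𝒰) : ∑ y, rxChan₂ pT fx fw ch s v u y = 1 := by
  simp only [rxChan₂]
  rw [Finset.sum_comm]
  simp only [← Finset.mul_sum]
  simp only [Finset.sum_comm (s := (Finset.univ : Finset 𝒴₂)), hch1, mul_one, hpT.2]

theorem pushf_hkBaseJoint₁ :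
    pushf (hkBaseJoint pS pT pU pV fx fw ch) (fun ω => (ω.1, ω.2.1, ω.2.2.1, ω.2.2.2.2.1))
      = model pS id pT id pU id (rxChan₁ pV fx fw ch) := by
  funext b
  rw [pushf_eq_sum_of_equiv (R := 𝒱 × 𝒴₂) _ _
    ⟨fun x => (x.1.1, x.1.2.1, x.1.2.2.1, x.2.1, x.1.2.2.2, x.2.2),
      fun ω => ((ω.1, ω.2.1, ω.2.2.1, ω.2.2.2.2.1), (ω.2.2.2.1, ω.2.2.2.2.2)),
      fun _ => rfl, fun _ => rfl⟩ (fun _ => rfl)]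
  simp only [Equiv.coe_fn_mk, hkBaseJoint, model, rxChan₁, id, Fintype.sum_prod_type,
    Finset.mul_sum]
  exact Finset.sum_congr rfl fun _ _ => Finset.sum_congr rfl fun _ _ => by ring

theorem pushf_hkBaseJoint₂ :
    pushf (hkBaseJoint pS pT pU pV fx fw ch) (fun ω => (ω.1, ω.2.2.2.1, ω.2.2.1, ω.2.2.2.2.2))
      = model pS id pV id pU id (rxChan₂ pT fx fw ch) := by
  funext b
  rw [pushf_eq_sum_of_equiv (R := 𝒯 × 𝒴₁) _ _
    ⟨fun x => (x.1.1, x.2.1, x.1.2.2.1, x.1.2.1, x.2.2, x.1.2.2.2),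
      fun ω => ((ω.1, ω.2.2.2.1, ω.2.2.1, ω.2.2.2.2.2), (ω.2.1, ω.2.2.2.2.1)),
      fun _ => rfl, fun _ => rfl⟩ (fun _ => rfl)]
  simp only [Equiv.coe_fn_mk, hkBaseJoint, model, rxChan₂, id, Fintype.sum_prod_type,
    Finset.mul_sum]
  exact Finset.sum_congr rfl fun _ _ => Finset.sum_congr rfl fun _ _ => by ring

variable (σ : HKSplit 𝒮 𝒯 𝒰 𝒱)

theorem pushf_hkJoint₁ (h : σ.Matches pS pT pV) :
    pushf (hkJoint fx fw σ pU ch)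
        (fun ω => ((ω.1, ω.2.1, ω.2.2.1), (ω.2.2.2.1, ω.2.2.2.2.1), ω.2.2.2.2.2.1,
          ω.2.2.2.2.2.2.2.2.1))
      = model (fun x : σ.S1 × σ.S2 × σ.S3 => σ.pS1 x.1 * σ.pS2 x.2.1 * σ.pS3 x.2.2)
          (fun x => σ.fs x.1 x.2.1 x.2.2) (fun x : σ.T1 × σ.T2 => σ.pT1 x.1 * σ.pT2 x.2)
          (fun x => σ.ft x.1 x.2) pU id (rxChan₁ pV fx fw ch) := by
  funext b
  rw [pushf_eq_sum_of_equiv (R := (σ.V1 × σ.V2) × 𝒴₂) _ _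
    ⟨fun x => (x.1.1.1, x.1.1.2.1, x.1.1.2.2, x.1.2.1.1, x.1.2.1.2, x.1.2.2.1, x.2.1.1, x.2.1.2,
        x.1.2.2.2, x.2.2),
      fun ω => (((ω.1, ω.2.1, ω.2.2.1), (ω.2.2.2.1, ω.2.2.2.2.1), ω.2.2.2.2.2.1,
        ω.2.2.2.2.2.2.2.2.1), ((ω.2.2.2.2.2.2.1, ω.2.2.2.2.2.2.2.1), ω.2.2.2.2.2.2.2.2.2)),
      fun _ => rfl, fun _ => rfl⟩ (fun _ => rfl)]
  simp only [Equiv.coe_fn_mk, hkJoint, model, rxChan₁, id]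
  rw [← funext h.2.2, sum_pushf_mul _ _ fun v => ∑ y₂, ch _ (fw _ v) _ y₂, Fintype.sum_prod_type]
  simp only [Finset.mul_sum]
  exact Finset.sum_congr rfl fun _ _ => Finset.sum_congr rfl fun _ _ => by ring

theorem pushf_hkJoint₂ (h : σ.Matches pS pT pV) :
    pushf (hkJoint fx fw σ pU ch)
        (fun ω => ((ω.1, ω.2.1, ω.2.2.1), (ω.2.2.2.2.2.2.1, ω.2.2.2.2.2.2.2.1), ω.2.2.2.2.2.1,
          ω.2.2.2.2.2.2.2.2.2))
      = model (fun x : σ.S1 × σ.S2 × σ.S3 => σ.pS1 x.1 * σ.pS2 x.2.1 * σ.pS3 x.2.2)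
          (fun x => σ.fs x.1 x.2.1 x.2.2) (fun x : σ.V1 × σ.V2 => σ.pV1 x.1 * σ.pV2 x.2)
          (fun x => σ.fv x.1 x.2) pU id (rxChan₂ pT fx fw ch) := by
  funext b
  rw [pushf_eq_sum_of_equiv (R := (σ.T1 × σ.T2) × 𝒴₁) _ _
    ⟨fun x => (x.1.1.1, x.1.1.2.1, x.1.1.2.2, x.2.1.1, x.2.1.2, x.1.2.2.1, x.1.2.1.1, x.1.2.1.2,
        x.2.2, x.1.2.2.2),
      fun ω => (((ω.1, ω.2.1, ω.2.2.1), (ω.2.2.2.2.2.2.1, ω.2.2.2.2.2.2.2.1), ω.2.2.2.2.2.1,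
        ω.2.2.2.2.2.2.2.2.2), ((ω.2.2.2.1, ω.2.2.2.2.1), ω.2.2.2.2.2.2.2.2.1)),
      fun _ => rfl, fun _ => rfl⟩ (fun _ => rfl)]
  simp only [Equiv.coe_fn_mk, hkJoint, model, rxChan₂, id]
  rw [← funext h.2.1, sum_pushf_mul _ _ fun t => ∑ y₁, ch (fx _ t) _ y₁ _, Fintype.sum_prod_type]
  simp only [Finset.mul_sum]
  exact Finset.sum_congr rfl fun _ _ => Finset.sum_congr rfl fun _ _ => by ring

end Receivers

section Chains

variable {S T U Y : Type} [Fintype S] [Fintype T] [Fintype U] [Fintype Y] {a b c : ℕ}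

/-- Each level of `E` is an average which every later level refines. -/
def IsChain (E : Fin a → ((S → ℝ) → ℝ) → ℝ) : Prop :=
  (∀ i, IsAverage (E i)) ∧ ∀ i i', i < i' → Refines (E i) (E i')

theorem pairSubmodular_obsTable {W : S → T → U → Y → ℝ} (hW : ∀ s t u v, 0 ≤ W s t u v)
    {E : Fin a → ((S → ℝ) → ℝ) → ℝ} {F : Fin b → ((T → ℝ) → ℝ) → ℝ}
    {G : Fin c → ((U → ℝ) → ℝ) → ℝ} (hE : IsChain E) (hF : IsChain F) (hG : IsChain G) :
    PairSubmodular (obsTable W E F G) :=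
  ⟨fun i i' j j' k hi hj => obsEnt_submodular_left hW (hE.2 i i' hi) (hF.2 j j' hj) (hG.1 k),
    fun i i' j k k' hi hk => obsEnt_submodular_outer hW (hE.2 i i' hi) (hF.1 j) (hG.2 k k' hk),
    fun i j j' k k' hj hk => obsEnt_submodular_right hW (hE.1 i) (hF.2 j j' hj) (hG.2 k k' hk)⟩

theorem isChain_inputLevels {p : S → ℝ} (hp : ∀ s, 0 ≤ p s) : IsChain (inputLevels p) := by
  have h := refines_unobserved_observed hp
  constructor
  · intro i
    fin_cases i
    exacts [h.isAverage_left, h.isAverage_right]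
  · intro i i' hi
    fin_cases i <;> fin_cases i' <;> first | exact h | exact absurd hi (by decide)

theorem isChain_layer {A B : Type} [Fintype A] [Fintype B] {pA : A → ℝ} {pB : B → ℝ}
    (hA : ∀ a, 0 ≤ pA a) (hB : ∀ b, 0 ≤ pB b) {f : A → B → S} {p : S → ℝ} (hp : ∀ s, 0 ≤ p s)
    (h : pushf (fun x : A × B => pA x.1 * pB x.2) (fun x => f x.1 x.2) = p) :
    IsChain (twoLevels p pA pB f) := by
  have h' : ∀ s, ∑ a, pA a * ∑ b, pB b * pointMass (f a b) s = p s := by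
    intro s
    rw [← h, pushf_eq_sum_mul, Fintype.sum_prod_type]
    simp only [Finset.mul_sum, mul_assoc, pointMass]
  have h1 := refines_unobserved_layerObs hA hB h'
  have h2 := refines_layerObs_observed hA hB h'
  have h3 := refines_unobserved_observed hp
  constructor
  · intro i
    fin_cases i
    exacts [h1.isAverage_left, h1.isAverage_right, h2.isAverage_right]
  · intro i i' hi
    fin_cases i <;> fin_cases i' <;>
      first | exact h1 | exact h2 | exact h3 | exact absurd hi (by decide)

theorem isChain_threeLevels_fst {A B C : Type} [Fintype A] [Fintype B] [Fintype C] {pA : A → ℝ}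
    {pB : B → ℝ} {pC : C → ℝ} (hA : ∀ a, 0 ≤ pA a) (hB : ∀ b, 0 ≤ pB b) (hC : ∀ c, 0 ≤ pC c)
    {f : A → B → C → S} {p : S → ℝ} (hp : ∀ s, 0 ≤ p s)
    (h : pushf (fun x : A × B × C => pA x.1 * pB x.2.1 * pC x.2.2)
      (fun x => f x.1 x.2.1 x.2.2) = p) :
    IsChain fun i => threeLevels p pA pB pC f (![0, 1, 3] i) := by
  have e : (fun i => threeLevels p pA pB pC f (![0, 1, 3] i))
      = twoLevels p pA (fun x : B × C => pB x.1 * pC x.2) (fun a x => f a x.1 x.2) := by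
    funext i
    fin_cases i <;> rfl
  rw [e]
  refine isChain_layer hA (fun x => mul_nonneg (hB _) (hC _)) hp ?_
  simpa only [mul_assoc] using h

theorem isChain_threeLevels_snd {A B C : Type} [Fintype A] [Fintype B] [Fintype C] {pA : A → ℝ}
    {pB : B → ℝ} {pC : C → ℝ} (hA : ∀ a, 0 ≤ pA a) (hB : ∀ b, 0 ≤ pB b) (hC : ∀ c, 0 ≤ pC c)
    {f : A → B → C → S} {p : S → ℝ} (hp : ∀ s, 0 ≤ p s)
    (h : pushf (fun x : A × B × C => pA x.1 * pB x.2.1 * pC x.2.2)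
      (fun x => f x.1 x.2.1 x.2.2) = p) :
    IsChain fun i => threeLevels p pA pB pC f (![0, 2, 3] i) := by
  have e : (fun i => threeLevels p pA pB pC f (![0, 2, 3] i))
      = twoLevels p (fun x : A × B => pA x.1 * pB x.2) pC (fun x c => f x.1 x.2 c) := by
    funext i
    fin_cases i <;> rfl
  rw [e]
  refine isChain_layer (fun x => mul_nonneg (hA _) (hB _)) hC hp ?_
  rw [← h]
  funext s
  simp only [pushf]
  exact (Equiv.prodAssoc A B C).sum_comp
    fun x : A × B × C => if f x.1 x.2.1 x.2.2 = s then pA x.1 * pB x.2.1 * pC x.2.2 else 0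

/-- The rates of one of the three kinds of layer order. -/
def AnyOrder (K : Fin 3 → Fin 3 → Fin 2 → ℝ) (rS rT rU : ℝ) : Prop :=
  OrderSTSUT K rS rT rU ∨ OrderTUSTS K rS rT rU ∨ OrderTSUST K rS rT rU

end Chains

section Erasure

variable {S T U Y : Type} [Fintype S] [Fintype T] [Fintype U] [Fintype Y]

/-- Law of a layer which reveals an input of law `p` with probability `a`. -/
def eraseLaw (a : ℝ) (p : S → ℝ) (o : Option S) : ℝ := o.elim (1 - a) fun s => a * p s

/-- Observation of an input of law `p` with probability `a`. -/
def mixLevel (p : S → ℝ) (a : ℝ) (F : (S → ℝ) → ℝ) : ℝ :=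
  (1 - a) * unobserved p F + a * observed p F

theorem isPMF_eraseLaw {p : S → ℝ} (hp : IsPMF p) {a : ℝ} (h0 : 0 ≤ a) (h1 : a ≤ 1) :
    IsPMF (eraseLaw a p) := by
  constructor
  · rintro (_ | s)
    · exact sub_nonneg.2 h1
    · exact mul_nonneg h0 (hp.1 s)
  · simp [Fintype.sum_option, eraseLaw, ← Finset.mul_sum, hp.2]

theorem sum_eraseLaw_mul (a : ℝ) (p : S → ℝ) (G : Option S → ℝ) :
    ∑ o, eraseLaw a p o * G o = (1 - a) * G none + a * ∑ s, p s * G (some s) := by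
  simp [Fintype.sum_option, eraseLaw, Finset.mul_sum, mul_assoc]

theorem sum_eraseLaw_getD {p : S → ℝ} (hp : ∑ s, p s = 1) (a : ℝ) (G : S → ℝ) :
    ∑ o, eraseLaw a p o * ∑ s, p s * G (o.getD s) = ∑ s, p s * G s := by
  rw [sum_eraseLaw_mul]
  simp only [Option.getD_none, Option.getD_some, ← Finset.sum_mul, hp, one_mul]
  ring

theorem pushf_eraseLaw {p : S → ℝ} (hp : ∑ s, p s = 1) (a : ℝ) :
    pushf (fun x : Option S × S => eraseLaw a p x.1 * p x.2) (fun x => x.1.getD x.2) = p := by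
  funext s'
  rw [pushf_eq_sum_mul, Fintype.sum_prod_type]
  simp only [mul_assoc, ← Finset.mul_sum]
  rw [sum_eraseLaw_getD hp a fun s => if s = s' then 1 else 0]
  simp

theorem pushf_eraseLaw_eraseLaw {p : S → ℝ} (hp : ∑ s, p s = 1) (a b : ℝ) :
    pushf (fun x : Option S × Option S × S => eraseLaw a p x.1 * eraseLaw b p x.2.1 * p x.2.2)
      (fun x => x.1.getD (x.2.1.getD x.2.2)) = p := by
  funext s'
  rw [pushf_eq_sum_mul]
  simp only [Fintype.sum_prod_type, mul_assoc, ← Finset.mul_sum]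
  have h : ∀ o : Option S, ∑ o', eraseLaw b p o' *
      ∑ s, p s * (if o.getD (o'.getD s) = s' then (1 : ℝ) else 0)
      = ∑ s, p s * if o.getD s = s' then 1 else 0 := fun o =>
    sum_eraseLaw_getD hp b fun s => if o.getD s = s' then 1 else 0
  simp only [h]
  rw [sum_eraseLaw_getD hp a fun s => if s = s' then 1 else 0]
  simp

theorem layerLaw_eq_pointMass {A B : Type} [Fintype B] {pB : B → ℝ} (hB : ∑ b, pB b = 1)
    {f : A → B → S} {a : A} {s : S} (h : ∀ b, f a b = s) : layerLaw pB f a = pointMass s := by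
  funext s'
  simp only [layerLaw, h, ← Finset.sum_mul, hB, one_mul]

theorem layerLaw_eq_pushf {A B : Type} [Fintype B] (pB : B → ℝ) (f : A → B → S) (a : A) :
    layerLaw pB f a = pushf pB (f a) := by
  funext s'
  simp only [layerLaw, pushf_eq_sum_mul, pointMass]

theorem pushf_id (p : S → ℝ) : pushf p (fun s => s) = p := by
  funext s
  simp [pushf]

theorem twoLevels_eraseLaw {p : S → ℝ} (hp : ∑ s, p s = 1) (a : ℝ) :
    twoLevels p (eraseLaw a p) p Option.getD = ![unobserved p, mixLevel p a, observed p] := by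
  rw [twoLevels]
  congr 2
  funext F
  rw [layerObs, avg, sum_eraseLaw_mul]
  have h0 : layerLaw p Option.getD (none : Option S) = p := by
    rw [layerLaw_eq_pushf]
    exact pushf_id p
  have h1 : ∀ s : S, layerLaw p Option.getD (some s) = pointMass s := fun s =>
    layerLaw_eq_pointMass hp fun _ => rfl
  simp only [h0, h1]
  rfl

theorem threeLevels_eraseLaw {p : S → ℝ} (hp : ∑ s, p s = 1) {a b a' : ℝ}
    (hb : IsPMF (eraseLaw b p)) (ha' : 1 - (1 - a) * (1 - b) = a') :
    threeLevels p (eraseLaw a p) (eraseLaw b p) p (fun o o' s => o.getD (o'.getD s))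
      = ![unobserved p, mixLevel p a, mixLevel p a', observed p] := by
  rw [threeLevels]
  congr 2
  · funext F
    rw [layerObs, avg, sum_eraseLaw_mul]
    have h0 : layerLaw (fun x : Option S × S => eraseLaw b p x.1 * p x.2)
        (fun (o : Option S) x => o.getD (x.1.getD x.2)) none = p := by
      rw [layerLaw_eq_pushf]
      exact pushf_eraseLaw hp b
    have h1 : ∀ s, layerLaw (fun x : Option S × S => eraseLaw b p x.1 * p x.2)
        (fun (o : Option S) x => o.getD (x.1.getD x.2)) (some s) = pointMass s := fun s =>
      layerLaw_eq_pointMass (sum_prod_mul hb.2 hp) fun _ => rfl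
    simp only [h0, h1]
    rfl
  · congr 1
    funext F
    rw [layerObs, avg, Fintype.sum_prod_type]
    simp only [mul_assoc, ← Finset.mul_sum, sum_eraseLaw_mul]
    have h0 : layerLaw p (fun (x : Option S × Option S) s => x.1.getD (x.2.getD s)) (none, none)
        = p := by
      rw [layerLaw_eq_pushf]
      exact pushf_id p
    have h1 : ∀ s, layerLaw p (fun (x : Option S × Option S) s => x.1.getD (x.2.getD s))
        (none, some s) = pointMass s := fun s => layerLaw_eq_pointMass hp fun _ => rfl
    have h2 : ∀ s o, layerLaw p (fun (x : Option S × Option S) s => x.1.getD (x.2.getD s))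
        (some s, o) = pointMass s := fun s o => layerLaw_eq_pointMass hp fun _ => rfl
    simp only [h0, h1, h2, ← Finset.sum_mul, hp, mixLevel, unobserved, observed, ← ha']
    ring_nf

theorem obsTable_mixLevel (W : S → T → U → Y → ℝ) (pS : S → ℝ) (pT : T → ℝ) (pU : U → ℝ)
    (a b : ℝ) :
    obsTable W ![unobserved pS, mixLevel pS a, observed pS]
        ![unobserved pT, mixLevel pT b, observed pT] (inputLevels pU)
      = interp (obsTable W (inputLevels pS) (inputLevels pT) (inputLevels pU)) a b := by
  have hl : ∀ F G, obsEnt W (mixLevel pS a) F G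
      = (1 - a) * obsEnt W (unobserved pS) F G + a * obsEnt W (observed pS) F G := fun _ _ => rfl
  have hu : ∀ G, obsEnt W (unobserved pS) (mixLevel pT b) G
      = (1 - b) * obsEnt W (unobserved pS) (unobserved pT) G
        + b * obsEnt W (unobserved pS) (observed pT) G := fun _ => rfl
  have ho : ∀ G, obsEnt W (observed pS) (mixLevel pT b) G
      = (1 - b) * obsEnt W (observed pS) (unobserved pT) G
        + b * obsEnt W (observed pS) (observed pT) G := by
    intro G
    rw [obsEnt, observed]
    simp only [mixLevel, mul_add, Finset.sum_add_distrib, mul_left_comm (pS _), ← Finset.mul_sum]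
    rfl
  funext i j k
  fin_cases i <;> fin_cases j <;>
    simp [obsTable, interp, inputLevels, hl, hu, ho]

theorem exists_second_weight {a a' : ℝ} (h : a ≤ a') (h1 : a' ≤ 1) :
    ∃ b, 0 ≤ b ∧ b ≤ 1 ∧ 1 - (1 - a) * (1 - b) = a' := by
  obtain ⟨b, h0, h1, hb⟩ := exists_mix h h1
  exact ⟨b, h0, h1, by rw [hb]; ring⟩

end Erasure

section Regions

theorem sum_eq_one_of_pushf {Ω β : Type*} [Fintype Ω] [Fintype β] {q : Ω → ℝ} {f : Ω → β}
    {p : β → ℝ} (h : pushf q f = p) (hp : ∑ b, p b = 1) : ∑ ω, q ω = 1 := by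
  rw [← sum_pushf q f, h, hp]

/-- All four rates are nonnegative. -/
def IsNonneg (r : ℝ × ℝ × ℝ × ℝ) : Prop := 0 ≤ r.1 ∧ 0 ≤ r.2.1 ∧ 0 ≤ r.2.2.1 ∧ 0 ≤ r.2.2.2

theorem isNonneg_and_iff {r : ℝ × ℝ × ℝ × ℝ} {P Q : Prop} (h : P ↔ Q) :
    (0 ≤ r.1 ∧ 0 ≤ r.2.1 ∧ 0 ≤ r.2.2.1 ∧ 0 ≤ r.2.2.2 ∧ P) ↔ IsNonneg r ∧ Q := by
  simp only [IsNonneg, h, and_assoc]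

variable {pS : 𝒮 → ℝ} {pT : 𝒯 → ℝ} {pU : 𝒰 → ℝ} {pV : 𝒱 → ℝ}
  {fx : 𝒮 → 𝒯 → 𝒳} {fw : 𝒰 → 𝒱 → 𝒲} {ch : 𝒳 → 𝒲 → 𝒴₁ → 𝒴₂ → ℝ}

theorem mem_R1MACHK (hpS : IsPMF pS) (hpT : IsPMF pT) (hpU : IsPMF pU) (hpV : IsPMF pV)
    (hch1 : ∀ x w, ∑ y₁, ∑ y₂, ch x w y₁ y₂ = 1) {r : ℝ × ℝ × ℝ × ℝ} :
    r ∈ R1MACHK pS pT pU pV fx fw ch ↔ IsNonneg r ∧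
      MacBounds (obsTable (rxChan₁ pV fx fw ch) (inputLevels pS) (inputLevels pT)
        (inputLevels pU)) r.1 r.2.1 r.2.2.1 := by
  have hW := sum_rxChan₁ (fx := fx) (fw := fw) hpV hch1
  have hq : ∑ ω, hkBaseJoint pS pT pU pV fx fw ch ω = 1 :=
    sum_eq_one_of_pushf pushf_hkBaseJoint₁ (sum_model hW hpS.2 hpT.2 hpU.2)
  exact isNonneg_and_iff
    (rates_mac hq (tabulates_input hW hpS.2 hpT.2 hpU.2 pushf_hkBaseJoint₁))

theorem mem_R2MACHK (hpS : IsPMF pS) (hpT : IsPMF pT) (hpU : IsPMF pU) (hpV : IsPMF pV)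
    (hch1 : ∀ x w, ∑ y₁, ∑ y₂, ch x w y₁ y₂ = 1) {r : ℝ × ℝ × ℝ × ℝ} :
    r ∈ R2MACHK pS pT pU pV fx fw ch ↔ IsNonneg r ∧
      MacBounds (obsTable (rxChan₂ pT fx fw ch) (inputLevels pS) (inputLevels pV)
        (inputLevels pU)) r.1 r.2.2.2 r.2.2.1 := by
  have hW := sum_rxChan₂ (fx := fx) (fw := fw) hpT hch1
  have hq : ∑ ω, hkBaseJoint pS pT pU pV fx fw ch ω = 1 :=
    sum_eq_one_of_pushf pushf_hkBaseJoint₂ (sum_model hW hpS.2 hpV.2 hpU.2)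
  exact isNonneg_and_iff
    (rates_mac_swap hq (tabulates_input hW hpS.2 hpV.2 hpU.2 pushf_hkBaseJoint₂))

/-- Entropies at receiver 1 given the first layers of `S`, `T` and `U`. -/
def splitTable₁ (pS : 𝒮 → ℝ) (pT : 𝒯 → ℝ) (pU : 𝒰 → ℝ) (pV : 𝒱 → ℝ) (fx : 𝒮 → 𝒯 → 𝒳)
    (fw : 𝒰 → 𝒱 → 𝒲) (ch : 𝒳 → 𝒲 → 𝒴₁ → 𝒴₂ → ℝ) (σ : HKSplit 𝒮 𝒯 𝒰 𝒱) :
    Fin 4 → Fin 3 → Fin 2 → ℝ :=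
  obsTable (rxChan₁ pV fx fw ch) (threeLevels pS σ.pS1 σ.pS2 σ.pS3 σ.fs)
    (twoLevels pT σ.pT1 σ.pT2 σ.ft) (inputLevels pU)

/-- Entropies at receiver 2 given the first layers of `S`, `V` and `U`. -/
def splitTable₂ (pS : 𝒮 → ℝ) (pT : 𝒯 → ℝ) (pU : 𝒰 → ℝ) (pV : 𝒱 → ℝ) (fx : 𝒮 → 𝒯 → 𝒳)
    (fw : 𝒰 → 𝒱 → 𝒲) (ch : 𝒳 → 𝒲 → 𝒴₁ → 𝒴₂ → ℝ) (σ : HKSplit 𝒮 𝒯 𝒰 𝒱) :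
    Fin 4 → Fin 3 → Fin 2 → ℝ :=
  obsTable (rxChan₂ pT fx fw ch) (threeLevels pS σ.pS1 σ.pS2 σ.pS3 σ.fs)
    (twoLevels pV σ.pV1 σ.pV2 σ.fv) (inputLevels pU)

variable {σ : HKSplit 𝒮 𝒯 𝒰 𝒱}

theorem sum_hkJoint (hpS : IsPMF pS) (hpT : IsPMF pT) (hpU : IsPMF pU) (hpV : IsPMF pV)
    (hch1 : ∀ x w, ∑ y₁, ∑ y₂, ch x w y₁ y₂ = 1) (hσ : σ.Matches pS pT pV) :
    ∑ ω, hkJoint fx fw σ pU ch ω = 1 :=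
  sum_eq_one_of_pushf (pushf_hkJoint₁ σ hσ) (sum_model (sum_rxChan₁ hpV hch1)
    (sum_eq_one_of_pushf (funext hσ.1) hpS.2) (sum_eq_one_of_pushf (funext hσ.2.1) hpT.2) hpU.2)

theorem tabulates_splitTable₁ (hpS : IsPMF pS) (hpT : IsPMF pT) (hpU : IsPMF pU)
    (hpV : IsPMF pV) (hch1 : ∀ x w, ∑ y₁, ∑ y₂, ch x w y₁ y₂ = 1) (hσ : σ.Matches pS pT pV) :
    Tabulates (hkJoint fx fw σ pU ch) (fun ω => ω.2.2.2.2.2.2.2.2.1)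
      (splitRel (fun ω => ω.1) (fun ω => ω.2.1) (fun ω => ω.2.2.1) (fun ω => ω.2.2.2.1)
        (fun ω => ω.2.2.2.2.1) (fun ω => ω.2.2.2.2.2.1))
      (splitTable₁ pS pT pU pV fx fw ch σ) :=
  tabulates_split (sum_rxChan₁ hpV hch1) hpS.2 hpT.2 hpU.2 σ.pS2_pmf.2 σ.pS3_pmf.2 σ.pT2_pmf.2
    (funext hσ.1) (funext hσ.2.1) (pushf_hkJoint₁ σ hσ)

theorem tabulates_splitTable₂ (hpS : IsPMF pS) (hpT : IsPMF pT) (hpU : IsPMF pU)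
    (hpV : IsPMF pV) (hch1 : ∀ x w, ∑ y₁, ∑ y₂, ch x w y₁ y₂ = 1) (hσ : σ.Matches pS pT pV) :
    Tabulates (hkJoint fx fw σ pU ch) (fun ω => ω.2.2.2.2.2.2.2.2.2)
      (splitRel (fun ω => ω.1) (fun ω => ω.2.1) (fun ω => ω.2.2.1)
        (fun ω => ω.2.2.2.2.2.2.1) (fun ω => ω.2.2.2.2.2.2.2.1) (fun ω => ω.2.2.2.2.2.1))
      (splitTable₂ pS pT pU pV fx fw ch σ) :=
  tabulates_split (sum_rxChan₂ hpT hch1) hpS.2 hpV.2 hpU.2 σ.pS2_pmf.2 σ.pS3_pmf.2 σ.pV2_pmf.2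
    (funext hσ.1) (funext hσ.2.2) (pushf_hkJoint₂ σ hσ)

variable {r : ℝ × ℝ × ℝ × ℝ}

theorem exists_mem_R1Reg_early (hpS : IsPMF pS) (hpT : IsPMF pT) (hpU : IsPMF pU)
    (hpV : IsPMF pV) (hch1 : ∀ x w, ∑ y₁, ∑ y₂, ch x w y₁ y₂ = 1) (hσ : σ.Matches pS pT pV) :
    (∃ l, (l = .o1 ∨ l = .o2 ∨ l = .o3) ∧ r ∈ R1Reg fx fw σ pU ch l) ↔ IsNonneg r ∧
      AnyOrder (fun i j k => splitTable₁ pS pT pU pV fx fw ch σ (![0, 1, 3] i) j k)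
        r.1 r.2.1 r.2.2.1 := by
  have hq := sum_hkJoint (fx := fx) (fw := fw) hpS hpT hpU hpV hch1 hσ
  have ht := tabulates_splitTable₁ (fx := fx) (fw := fw) hpS hpT hpU hpV hch1 hσ
  simp only [or_and_right, exists_or, exists_eq_left, AnyOrder, and_or_left]
  exact or_congr (isNonneg_and_iff (rates_STSSUT hq ht))
    (or_congr (isNonneg_and_iff (rates_TUSTSS hq ht)) (isNonneg_and_iff (rates_TSUSST hq ht)))

theorem exists_mem_R1Reg_late (hpS : IsPMF pS) (hpT : IsPMF pT) (hpU : IsPMF pU)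
    (hpV : IsPMF pV) (hch1 : ∀ x w, ∑ y₁, ∑ y₂, ch x w y₁ y₂ = 1) (hσ : σ.Matches pS pT pV) :
    (∃ l, (l = .o4 ∨ l = .o5 ∨ l = .o6) ∧ r ∈ R1Reg fx fw σ pU ch l) ↔ IsNonneg r ∧
      AnyOrder (fun i j k => splitTable₁ pS pT pU pV fx fw ch σ (![0, 2, 3] i) j k)
        r.1 r.2.1 r.2.2.1 := by
  have hq := sum_hkJoint (fx := fx) (fw := fw) hpS hpT hpU hpV hch1 hσ
  have ht := tabulates_splitTable₁ (fx := fx) (fw := fw) hpS hpT hpU hpV hch1 hσ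
  simp only [or_and_right, exists_or, exists_eq_left, AnyOrder, and_or_left]
  exact or_congr (isNonneg_and_iff (rates_SSTSUT hq ht))
    (or_congr (isNonneg_and_iff (rates_TUSSTS hq ht)) (isNonneg_and_iff (rates_TSSUST hq ht)))

theorem exists_mem_R2Reg_early (hpS : IsPMF pS) (hpT : IsPMF pT) (hpU : IsPMF pU)
    (hpV : IsPMF pV) (hch1 : ∀ x w, ∑ y₁, ∑ y₂, ch x w y₁ y₂ = 1) (hσ : σ.Matches pS pT pV) :
    (∃ l, (l = .o7 ∨ l = .o8 ∨ l = .o9) ∧ r ∈ R2Reg fx fw σ pU ch l) ↔ IsNonneg r ∧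
      AnyOrder (fun i j k => splitTable₂ pS pT pU pV fx fw ch σ (![0, 1, 3] i) j k)
        r.1 r.2.2.2 r.2.2.1 := by
  have hq := sum_hkJoint (fx := fx) (fw := fw) hpS hpT hpU hpV hch1 hσ
  have ht := tabulates_splitTable₂ (fx := fx) (fw := fw) hpS hpT hpU hpV hch1 hσ
  simp only [or_and_right, exists_or, exists_eq_left, AnyOrder, and_or_left]
  exact or_congr (isNonneg_and_iff (rates_STSSUT hq ht))
    (or_congr (isNonneg_and_iff (rates_TUSTSS hq ht)) (isNonneg_and_iff (rates_TSUSST hq ht)))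

theorem exists_mem_R2Reg_late (hpS : IsPMF pS) (hpT : IsPMF pT) (hpU : IsPMF pU)
    (hpV : IsPMF pV) (hch1 : ∀ x w, ∑ y₁, ∑ y₂, ch x w y₁ y₂ = 1) (hσ : σ.Matches pS pT pV) :
    (∃ l, (l = .o10 ∨ l = .o11 ∨ l = .o12) ∧ r ∈ R2Reg fx fw σ pU ch l) ↔ IsNonneg r ∧
      AnyOrder (fun i j k => splitTable₂ pS pT pU pV fx fw ch σ (![0, 2, 3] i) j k)
        r.1 r.2.2.2 r.2.2.1 := by
  have hq := sum_hkJoint (fx := fx) (fw := fw) hpS hpT hpU hpV hch1 hσ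
  have ht := tabulates_splitTable₂ (fx := fx) (fw := fw) hpS hpT hpU hpV hch1 hσ
  simp only [or_and_right, exists_or, exists_eq_left, AnyOrder, and_or_left]
  exact or_congr (isNonneg_and_iff (rates_SSTSUT hq ht))
    (or_congr (isNonneg_and_iff (rates_TUSSTS hq ht)) (isNonneg_and_iff (rates_TSSUST hq ht)))

/-- Decoding `S` in two stages, the first of which reveals its first one or two layers, achieves
only rates within the multiple access bounds. -/
theorem macBounds_of_anyOrder {S T U Y A B C A' B' : Type} [Fintype S] [Fintype T] [Fintype U]
    [Fintype Y] [Fintype A] [Fintype B] [Fintype C] [Fintype A'] [Fintype B']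
    {W : S → T → U → Y → ℝ} (hW : ∀ s t u v, 0 ≤ W s t u v) {pS : S → ℝ} {pT : T → ℝ} {pU : U → ℝ}
    (hpS : IsPMF pS) (hpT : IsPMF pT) (hpU : IsPMF pU) {pA : A → ℝ} {pB : B → ℝ} {pC : C → ℝ}
    {f : A → B → C → S} {pA' : A' → ℝ} {pB' : B' → ℝ} {f' : A' → B' → T} (hA : IsPMF pA)
    (hB : IsPMF pB) (hC : IsPMF pC) (hA' : IsPMF pA') (hB' : IsPMF pB')
    (hf : pushf (fun x : A × B × C => pA x.1 * pB x.2.1 * pC x.2.2)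
      (fun x => f x.1 x.2.1 x.2.2) = pS)
    (hf' : pushf (fun x : A' × B' => pA' x.1 * pB' x.2) (fun x => f' x.1 x.2) = pT)
    {m : Fin 4} (hm : m = 1 ∨ m = 2) {rS rT rU : ℝ}
    (h : AnyOrder (fun i j k => obsTable W (threeLevels pS pA pB pC f) (twoLevels pT pA' pB' f')
      (inputLevels pU) (![0, m, 3] i) j k) rS rT rU) :
    MacBounds (obsTable W (inputLevels pS) (inputLevels pT) (inputLevels pU)) rS rT rU := by
  have hE : IsChain fun i => threeLevels pS pA pB pC f (![0, m, 3] i) := by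
    rcases hm with rfl | rfl
    · exact isChain_threeLevels_fst hA.1 hB.1 hC.1 hpS.1 hf
    · exact isChain_threeLevels_snd hA.1 hB.1 hC.1 hpS.1 hf
  have hK := pairSubmodular_obsTable hW hE (isChain_layer hA'.1 hB'.1 hpT.1 hf')
    (isChain_inputLevels hpU.1)
  have hc : corners (obsTable W (fun i => threeLevels pS pA pB pC f (![0, m, 3] i))
      (twoLevels pT pA' pB' f') (inputLevels pU))
      = obsTable W (inputLevels pS) (inputLevels pT) (inputLevels pU) := by
    funext i j k
    fin_cases i <;> fin_cases j <;> rfl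
  rw [← hc]
  exact macBounds_of_order hK h

/-- The split whose first two layers of `S` are erased copies of it. -/
def erasureSplit (hpS : IsPMF pS) (hpT : IsPMF pT) (hpV : IsPMF pV) {a b β β' : ℝ}
    (ha : IsPMF (eraseLaw a pS)) (hb : IsPMF (eraseLaw b pS)) (hβ : IsPMF (eraseLaw β pT))
    (hβ' : IsPMF (eraseLaw β' pV)) : HKSplit 𝒮 𝒯 𝒰 𝒱 where
  S1 := Option 𝒮
  S2 := Option 𝒮
  S3 := 𝒮
  T1 := Option 𝒯
  T2 := 𝒯
  V1 := Option 𝒱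
  V2 := 𝒱
  pS1 := eraseLaw a pS
  pS2 := eraseLaw b pS
  pS3 := pS
  pT1 := eraseLaw β pT
  pT2 := pT
  pV1 := eraseLaw β' pV
  pV2 := pV
  fs := fun o o' s => o.getD (o'.getD s)
  ft := Option.getD
  fv := Option.getD
  pS1_pmf := ha
  pS2_pmf := hb
  pS3_pmf := hpS
  pT1_pmf := hβ
  pT2_pmf := hpT
  pV1_pmf := hβ'
  pV2_pmf := hpV

/-- Any nested pair of observation probabilities for `S`, together with any observation
probabilities for `T` and `V`, come from a split. -/
theorem exists_split (hpS : IsPMF pS) (hpT : IsPMF pT) (hpV : IsPMF pV) {a a' β β' : ℝ}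
    (ha0 : 0 ≤ a) (ha : a ≤ a') (ha1 : a' ≤ 1) (hβ0 : 0 ≤ β) (hβ1 : β ≤ 1) (hβ0' : 0 ≤ β')
    (hβ1' : β' ≤ 1) (pU : 𝒰 → ℝ) (fx : 𝒮 → 𝒯 → 𝒳) (fw : 𝒰 → 𝒱 → 𝒲)
    (ch : 𝒳 → 𝒲 → 𝒴₁ → 𝒴₂ → ℝ) :
    ∃ σ : HKSplit 𝒮 𝒯 𝒰 𝒱, σ.Matches pS pT pV ∧
      splitTable₁ pS pT pU pV fx fw ch σ = obsTable (rxChan₁ pV fx fw ch)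
        ![unobserved pS, mixLevel pS a, mixLevel pS a', observed pS]
        ![unobserved pT, mixLevel pT β, observed pT] (inputLevels pU) ∧
      splitTable₂ pS pT pU pV fx fw ch σ = obsTable (rxChan₂ pT fx fw ch)
        ![unobserved pS, mixLevel pS a, mixLevel pS a', observed pS]
        ![unobserved pV, mixLevel pV β', observed pV] (inputLevels pU) := by
  obtain ⟨b, hb0, hb1, hb⟩ := exists_second_weight ha ha1
  have hB := isPMF_eraseLaw hpS hb0 hb1
  refine ⟨erasureSplit hpS hpT hpV (isPMF_eraseLaw hpS ha0 (ha.trans ha1)) hB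
    (isPMF_eraseLaw hpT hβ0 hβ1) (isPMF_eraseLaw hpV hβ0' hβ1'),
    ⟨congrFun (pushf_eraseLaw_eraseLaw hpS.2 a b), congrFun (pushf_eraseLaw hpT.2 β),
      congrFun (pushf_eraseLaw hpV.2 β')⟩, ?_, ?_⟩
  · rw [← threeLevels_eraseLaw hpS.2 hB hb, ← twoLevels_eraseLaw hpT.2]
    rfl
  · rw [← threeLevels_eraseLaw hpS.2 hB hb, ← twoLevels_eraseLaw hpV.2]
    rfl

theorem obsTable_skip {S T U Y : Type} [Fintype S] [Fintype T] [Fintype U] [Fintype Y]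
    (W : S → T → U → Y → ℝ) (pS : S → ℝ) (pT : T → ℝ) (pU : U → ℝ) (a a' β : ℝ) :
    (fun i j k => obsTable W ![unobserved pS, mixLevel pS a, mixLevel pS a', observed pS]
        ![unobserved pT, mixLevel pT β, observed pT] (inputLevels pU) (![0, 1, 3] i) j k)
      = interp (obsTable W (inputLevels pS) (inputLevels pT) (inputLevels pU)) a β ∧
    (fun i j k => obsTable W ![unobserved pS, mixLevel pS a, mixLevel pS a', observed pS]
        ![unobserved pT, mixLevel pT β, observed pT] (inputLevels pU) (![0, 2, 3] i) j k)
      = interp (obsTable W (inputLevels pS) (inputLevels pT) (inputLevels pU)) a' β := by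
  constructor <;>
  · rw [← obsTable_mixLevel]
    funext i j k
    fin_cases i <;> rfl

theorem mem_inter_iff_exists_split (hpS : IsPMF pS) (hpT : IsPMF pT) (hpU : IsPMF pU)
    (hpV : IsPMF pV) (hch0 : ∀ x w y₁ y₂, 0 ≤ ch x w y₁ y₂)
    (hch1 : ∀ x w, ∑ y₁, ∑ y₂, ch x w y₁ y₂ = 1) :
    r ∈ R1MACHK pS pT pU pV fx fw ch ∩ R2MACHK pS pT pU pV fx fw ch ↔
      ∃ σ : HKSplit 𝒮 𝒯 𝒰 𝒱, σ.Matches pS pT pV ∧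
        (((∃ l, (l = .o1 ∨ l = .o2 ∨ l = .o3) ∧ r ∈ R1Reg fx fw σ pU ch l) ∧
            ∃ l, (l = .o10 ∨ l = .o11 ∨ l = .o12) ∧ r ∈ R2Reg fx fw σ pU ch l) ∨
          (∃ l, (l = .o4 ∨ l = .o5 ∨ l = .o6) ∧ r ∈ R1Reg fx fw σ pU ch l) ∧
            ∃ l, (l = .o7 ∨ l = .o8 ∨ l = .o9) ∧ r ∈ R2Reg fx fw σ pU ch l) := by
  have hW₁ := rxChan₁_nonneg (fx := fx) (fw := fw) hpV hch0
  have hW₂ := rxChan₂_nonneg (fx := fx) (fw := fw) hpT hch0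
  rw [Set.mem_inter_iff, mem_R1MACHK hpS hpT hpU hpV hch1, mem_R2MACHK hpS hpT hpU hpV hch1]
  constructor
  · rintro ⟨⟨hr, h₁⟩, -, h₂⟩
    obtain ⟨a, β, ha0, ha1, hβ0, hβ1, h₁⟩ := exists_order_interp (pairSubmodular_obsTable hW₁
      (isChain_inputLevels hpS.1) (isChain_inputLevels hpT.1) (isChain_inputLevels hpU.1)) h₁
    obtain ⟨a', β', ha0', ha1', hβ0', hβ1', h₂⟩ := exists_order_interp (pairSubmodular_obsTable hW₂
      (isChain_inputLevels hpS.1) (isChain_inputLevels hpV.1) (isChain_inputLevels hpU.1)) h₂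
    rcases le_total a a' with h | h
    · obtain ⟨σ, hσ, e₁, e₂⟩ := exists_split hpS hpT hpV ha0 h ha1' hβ0 hβ1 hβ0' hβ1' pU fx fw ch
      refine ⟨σ, hσ, Or.inl ?_⟩
      rw [exists_mem_R1Reg_early hpS hpT hpU hpV hch1 hσ,
        exists_mem_R2Reg_late hpS hpT hpU hpV hch1 hσ, e₁, e₂, (obsTable_skip ..).1,
        (obsTable_skip ..).2]
      exact ⟨⟨hr, h₁⟩, hr, h₂⟩
    · obtain ⟨σ, hσ, e₁, e₂⟩ := exists_split hpS hpT hpV ha0' h ha1 hβ0 hβ1 hβ0' hβ1' pU fx fw ch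
      refine ⟨σ, hσ, Or.inr ?_⟩
      rw [exists_mem_R1Reg_late hpS hpT hpU hpV hch1 hσ,
        exists_mem_R2Reg_early hpS hpT hpU hpV hch1 hσ, e₁, e₂, (obsTable_skip ..).2,
        (obsTable_skip ..).1]
      exact ⟨⟨hr, h₁⟩, hr, h₂⟩
  · rintro ⟨σ, hσ, h⟩
    rw [exists_mem_R1Reg_early hpS hpT hpU hpV hch1 hσ,
      exists_mem_R2Reg_late hpS hpT hpU hpV hch1 hσ,
      exists_mem_R1Reg_late hpS hpT hpU hpV hch1 hσ,
      exists_mem_R2Reg_early hpS hpT hpU hpV hch1 hσ] at h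
    have k₁ := fun m hm => macBounds_of_anyOrder hW₁ hpS hpT hpU σ.pS1_pmf σ.pS2_pmf σ.pS3_pmf
      σ.pT1_pmf σ.pT2_pmf (funext hσ.1) (funext hσ.2.1) (m := m) hm (rS := r.1) (rT := r.2.1)
      (rU := r.2.2.1)
    have k₂ := fun m hm => macBounds_of_anyOrder hW₂ hpS hpV hpU σ.pS1_pmf σ.pS2_pmf σ.pS3_pmf
      σ.pV1_pmf σ.pV2_pmf (funext hσ.1) (funext hσ.2.2) (m := m) hm (rS := r.1) (rT := r.2.2.2)
      (rU := r.2.2.1)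
    rcases h with ⟨⟨hr, h₁⟩, -, h₂⟩ | ⟨⟨hr, h₁⟩, -, h₂⟩
    · exact ⟨⟨hr, k₁ 1 (Or.inl rfl) h₁⟩, hr, k₂ 2 (Or.inr rfl) h₂⟩
    · exact ⟨⟨hr, k₁ 2 (Or.inr rfl) h₁⟩, hr, k₂ 1 (Or.inl rfl) h₂⟩

end Regions

end HanKobayashi

/-- Lemma (HK split): `𝓡₁,MAC(p) ∩ 𝓡₂,MAC(p)` equals the union over refined splits
`p' ≃ p` of the unions of `𝓡₁(p',λ₁) ∩ 𝓡₂(p',λ₂)` over `λ₁ ∈ {1,2,3}, λ₂ ∈ {10,11,12}`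
and over `λ₁ ∈ {4,5,6}, λ₂ ∈ {7,8,9}`. -/
theorem hk_split_lemma
    (pS : 𝒮 → ℝ) (pT : 𝒯 → ℝ) (pU : 𝒰 → ℝ) (pV : 𝒱 → ℝ)
    (fx : 𝒮 → 𝒯 → 𝒳) (fw : 𝒰 → 𝒱 → 𝒲) (ch : 𝒳 → 𝒲 → 𝒴₁ → 𝒴₂ → ℝ)
    (hpS : IsPMF pS) (hpT : IsPMF pT) (hpU : IsPMF pU) (hpV : IsPMF pV)
    (hch0 : ∀ x w y₁ y₂, 0 ≤ ch x w y₁ y₂)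
    (hch1 : ∀ x w, ∑ y₁, ∑ y₂, ch x w y₁ y₂ = 1) :
    R1MACHK pS pT pU pV fx fw ch ∩ R2MACHK pS pT pU pV fx fw ch
      = ⋃ (s : HKSplit 𝒮 𝒯 𝒰 𝒱) (_ : s.Matches pS pT pV),
          ((⋃ (l₁ : HKOrder1) (_ : l₁ = .o1 ∨ l₁ = .o2 ∨ l₁ = .o3)
              (l₂ : HKOrder2) (_ : l₂ = .o10 ∨ l₂ = .o11 ∨ l₂ = .o12),
                (R1Reg fx fw s pU ch l₁ ∩ R2Reg fx fw s pU ch l₂)) ∪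
           (⋃ (l₁ : HKOrder1) (_ : l₁ = .o4 ∨ l₁ = .o5 ∨ l₁ = .o6)
              (l₂ : HKOrder2) (_ : l₂ = .o7 ∨ l₂ = .o8 ∨ l₂ = .o9),
                (R1Reg fx fw s pU ch l₁ ∩ R2Reg fx fw s pU ch l₂))) := by
  ext r
  rw [HanKobayashi.mem_inter_iff_exists_split hpS hpT hpU hpV hch0 hch1]
  simp only [Set.mem_iUnion, Set.mem_union, Set.mem_inter_iff, exists_prop]
  refine exists_congr fun σ => and_congr_right fun _ => or_congr ?_ ?_ <;>
  · constructor
    · rintro ⟨⟨l₁, h₁, m₁⟩, l₂, h₂, m₂⟩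
      exact ⟨l₁, h₁, l₂, h₂, m₁, m₂⟩
    · rintro ⟨l₁, h₁, l₂, h₂, m₁, m₂⟩
      exact ⟨⟨l₁, h₁, m₁⟩, l₂, h₂, m₂⟩
end
end

section
/- Lemma (independence through a Gaussian channel): Let (U,X) be jointly distributed with X ~ N(0,P), let N ~ N(0,1) be independent of (U,X), and set Y = X + N. If U and Y are independent (equivalently I(U;Y) = 0), then U and X are independent (equivalently I(U;X) = 0). -/
open MeasureTheory ProbabilityTheory
open scoped ENNReal NNReal

/-- Convolution with a finite measure whose characteristic function never vanishes is
injective on finite measures. -/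
theorem eq_of_conv_eq_conv_of_charFun_ne_zero {μ₁ μ₂ ν : Measure ℝ}
    [IsFiniteMeasure μ₁] [IsFiniteMeasure μ₂] [IsFiniteMeasure ν]
    (hν : ∀ t, charFun ν t ≠ 0) (h : μ₁ ∗ ν = μ₂ ∗ ν) : μ₁ = μ₂ := by
  refine Measure.ext_of_charFun (funext fun t => mul_right_cancel₀ (hν t) ?_)
  rw [← charFun_conv, ← charFun_conv, h]

/-- If `N` is independent of `(U, X)`, then on an event `{U ∈ A}` the law of `X + N` is the
convolution of the law of `X` on that event with the law of `N`. -/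
theorem ProbabilityTheory.IndepFun.map_add_restrict_preimage {Ω 𝒰 : Type*}
    [MeasurableSpace Ω] [MeasurableSpace 𝒰] {μ : Measure Ω} [IsFiniteMeasure μ]
    {U : Ω → 𝒰} {X N : Ω → ℝ} (hX : Measurable X) (hN : Measurable N)
    (h : IndepFun (fun ω => (U ω, X ω)) N μ) {A : Set 𝒰} (hA : MeasurableSet A) :
    (μ.restrict (U ⁻¹' A)).map (fun ω => X ω + N ω)
      = ((μ.restrict (U ⁻¹' A)).map X) ∗ (μ.map N) := by
  have hprod : ((μ.restrict (U ⁻¹' A)).map X).prod (μ.map N)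
      = (μ.restrict (U ⁻¹' A)).map (fun ω => (X ω, N ω)) := by
    refine Measure.prod_eq fun s t hs ht => ?_
    rw [Measure.map_apply (hX.prodMk hN) (hs.prod ht), Measure.map_apply hX hs,
      Measure.map_apply hN ht, Measure.restrict_apply (hX.prodMk hN (hs.prod ht)),
      Measure.restrict_apply (hX hs)]
    convert h.measure_inter_preimage_eq_mul (A ×ˢ s) t (hA.prod hs) ht using 2
    · ext ω
      simp only [Set.mem_inter_iff, Set.mem_preimage, Set.mem_prod]
      tauto
    · congr 1
      ext ω
      simp only [Set.mem_inter_iff, Set.mem_preimage, Set.mem_prod]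
      tauto
  rw [Measure.conv, hprod, Measure.map_map (by fun_prop) (hX.prodMk hN)]
  rfl

/-- Lemma (independence through a Gaussian channel): if `X ~ N(0,P)`, `N ~ N(0,1)` is
independent of `(U,X)`, `Y = X + N`, and `U` is independent of `Y` (equivalently
`I(U;Y) = 0`), then `U` is independent of `X` (equivalently `I(U;X) = 0`). -/
theorem indep_through_gaussian_channel {Ω 𝒰 : Type*}
    [MeasurableSpace Ω] [MeasurableSpace 𝒰]
    (μpr : Measure Ω) [IsProbabilityMeasure μpr] (P : ℝ≥0) (hP : 0 < P)
    (U : Ω → 𝒰) (X N : Ω → ℝ)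
    (hU : Measurable U) (hX : Measurable X) (hN : Measurable N)
    (hlawX : μpr.map X = gaussianReal 0 P)
    (hlawN : μpr.map N = gaussianReal 0 1)
    (hindep : IndepFun (fun ω => (U ω, X ω)) N μpr)
    (hUY : IndepFun U (fun ω => X ω + N ω) μpr) :
    IndepFun U X μpr := by
  rw [indepFun_iff_measure_inter_preimage_eq_mul]
  intro A B hA hB
  have hadd : Measurable fun ω => X ω + N ω := hX.add hN
  have hY : μpr.map (fun ω => X ω + N ω) = (μpr.map X) ∗ (μpr.map N) := by
    simpa using hindep.map_add_restrict_preimage hX hN MeasurableSet.univ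
  have hres : (μpr.restrict (U ⁻¹' A)).map (fun ω => X ω + N ω)
      = μpr (U ⁻¹' A) • μpr.map (fun ω => X ω + N ω) := by
    ext s hs
    rw [Measure.map_apply hadd hs, Measure.restrict_apply (hadd hs), Measure.smul_apply,
      Measure.map_apply hadd hs, smul_eq_mul, Set.inter_comm]
    exact hUY.measure_inter_preimage_eq_mul A s hA hs
  have : IsFiniteMeasure (μpr (U ⁻¹' A) • μpr.map X) :=
    Measure.smul_finite _ (measure_ne_top _ _)
  have hconv : ((μpr.restrict (U ⁻¹' A)).map X) ∗ (μpr.map N)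
      = (μpr (U ⁻¹' A) • μpr.map X) ∗ (μpr.map N) := by
    rw [← hindep.map_add_restrict_preimage hX hN hA, hres, hY, Measure.conv, Measure.conv,
      Measure.prod_smul_left, Measure.map_smul]
  have hcf : ∀ t, charFun (μpr.map N) t ≠ 0 := fun t => by
    rw [hlawN, charFun_gaussianReal]
    exact Complex.exp_ne_zero _
  have hXA := congrArg (fun ρ => ρ B) (eq_of_conv_eq_conv_of_charFun_ne_zero hcf hconv)
  simpa [Measure.map_apply hX hB, Measure.restrict_apply (hX hB), Set.inter_comm] using hXA
end
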